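/- arXiv:1602.07594 — 7 statements merged into one kernel-verified Lean document; each statement's English description precedes it below -/
import Mathlib

section
/- Let W : ℝ^{2×2} → [0,∞) be C² in a neighborhood of the identity matrix, frame indifferent (W(RX) = W(X) for every R ∈ SO(2) and every X ∈ ℝ^{2×2}), and vanishing on SO(2) (so in particular W attains its minimum 0 at the identity). Let Q be the Hessian quadratic form of W at the identity, i.e. Q(X) = (d²/dt²)|_{t=0} W(Id + tX). Then Q(X) = Q(sym X) for every X ∈ ℝ^{2×2}, where sym X = (X + Xᵀ)/2; in particular Q(A) = 0 for every skew-symmetric 2×2 matrix A. -/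
/-! STATEMENT 0: If `W : ℝ^{2×2} → [0,∞)` is C² near the identity, frame indifferent and
vanishes on SO(2), then the Hessian quadratic form `Q` of `W` at the identity satisfies
`Q(X) = Q(sym X)` for all `X`; in particular `Q(A) = 0` for skew-symmetric `A`. -/

attribute [local instance] Matrix.frobeniusNormedAddCommGroup Matrix.frobeniusNormedSpace

/-- `SO(2)`: real 2×2 matrices with `RᵀR = Id` and `det R = 1`. -/
def SO2 : Set (Matrix (Fin 2) (Fin 2) ℝ) :=
  {R | R.transpose * R = 1 ∧ R.det = 1}

/-- The symmetric part `(X + Xᵀ)/2` of a 2×2 matrix. -/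
noncomputable def symPart (X : Matrix (Fin 2) (Fin 2) ℝ) : Matrix (Fin 2) (Fin 2) ℝ :=
  (2⁻¹ : ℝ) • (X + X.transpose)

/-- The Hessian quadratic form of `W` at the identity:
`Q(X) = (d²/dt²)|_{t=0} W(Id + tX)`. -/
noncomputable def hessQ (W : Matrix (Fin 2) (Fin 2) ℝ → ℝ)
    (X : Matrix (Fin 2) (Fin 2) ℝ) : ℝ :=
  iteratedDeriv 2 (fun t : ℝ => W (1 + t • X)) 0

/-- At a critical point the second derivative of `f` along a curve depends only on the velocity
of the curve. -/
theorem iteratedDeriv_two_comp_of_fderiv_eq_zero {E : Type*} [NormedAddCommGroup E]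
    [NormedSpace ℝ E] {f : E → ℝ} {γ : ℝ → E} {x : ℝ} (hf : ContDiffAt ℝ 2 f (γ x))
    (hγ : ContDiffAt ℝ 2 γ x) (hcrit : fderiv ℝ f (γ x) = 0) :
    iteratedDeriv 2 (fun t => f (γ t)) x =
      fderiv ℝ (fderiv ℝ f) (γ x) (deriv γ x) (deriv γ x) := by
  have hfev : ∀ᶠ t in nhds x, DifferentiableAt ℝ f (γ t) :=
    hγ.continuousAt.eventually
      ((hf.eventually (by simp)).mono fun y hy => hy.differentiableAt (by simp))
  have hγev : ∀ᶠ t in nhds x, DifferentiableAt ℝ γ t :=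
    (hγ.eventually (by simp)).mono fun t ht => ht.differentiableAt (by simp)
  have hderiv : deriv (fun t => f (γ t)) =ᶠ[nhds x] fun t => fderiv ℝ f (γ t) (deriv γ t) := by
    filter_upwards [hfev, hγev] with t hft hγt
    exact (hft.hasFDerivAt.comp_hasDerivAt t hγt.hasDerivAt).deriv
  have hdf : DifferentiableAt ℝ (fderiv ℝ f) (γ x) :=
    (hf.fderiv_right (m := 1) (by norm_num)).differentiableAt (by simp)
  have hdγ : DifferentiableAt ℝ (deriv γ) x := by
    have h : DifferentiableAt ℝ (fderiv ℝ γ) x :=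
      (hγ.fderiv_right (m := 1) (by norm_num)).differentiableAt (by simp)
    exact h.clm_apply (differentiableAt_const (1 : ℝ))
  have hγx := (hγ.differentiableAt (by simp)).hasDerivAt
  rw [iteratedDeriv_succ, iteratedDeriv_one, hderiv.deriv_eq]
  refine ((hdf.hasFDerivAt.comp_hasDerivAt x hγx).clm_apply hdγ.hasDerivAt).deriv.trans ?_
  simp [hcrit]

/-- The infinitesimal generator of the plane rotations. -/
def planeRotationGenerator : Matrix (Fin 2) (Fin 2) ℝ := !![0, -1; 1, 0]

theorem planeRotation_mem_SO2 (θ : ℝ) :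
    Real.cos θ • (1 : Matrix (Fin 2) (Fin 2) ℝ) + Real.sin θ • planeRotationGenerator ∈ SO2 := by
  have h := Real.cos_sq_add_sin_sq θ
  refine ⟨?_, ?_⟩
  · ext i j
    fin_cases i <;> fin_cases j <;>
      simp [planeRotationGenerator, Matrix.mul_apply, Fin.sum_univ_two] <;> linarith
  · simp [planeRotationGenerator, Matrix.det_fin_two]
    linarith

theorem smul_planeRotationGenerator_add_symPart (X : Matrix (Fin 2) (Fin 2) ℝ) :
    ((X 1 0 - X 0 1) / 2) • planeRotationGenerator + symPart X = X := by
  ext i j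
  fin_cases i <;> fin_cases j <;> simp [planeRotationGenerator, symPart] <;> ring

theorem hessQ_zero (W : Matrix (Fin 2) (Fin 2) ℝ → ℝ) : hessQ W 0 = 0 := by
  simp [hessQ, iteratedDeriv_const]

theorem symPart_eq_zero {A : Matrix (Fin 2) (Fin 2) ℝ} (hA : A.transpose = -A) :
    symPart A = 0 := by
  simp [symPart, hA]

theorem hessQ_eq_hessQ_symPart_of_frame_indifferent
    (W : Matrix (Fin 2) (Fin 2) ℝ → ℝ)
    (hWnonneg : ∀ X, 0 ≤ W X)
    (hreg : ∃ U : Set (Matrix (Fin 2) (Fin 2) ℝ),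
      IsOpen U ∧ (1 : Matrix (Fin 2) (Fin 2) ℝ) ∈ U ∧ ContDiffOn ℝ 2 W U)
    (hframe : ∀ R ∈ SO2, ∀ X : Matrix (Fin 2) (Fin 2) ℝ, W (R * X) = W X)
    (hvanish : ∀ R ∈ SO2, W R = 0) :
    (∀ X : Matrix (Fin 2) (Fin 2) ℝ, hessQ W X = hessQ W (symPart X)) ∧
    (∀ A : Matrix (Fin 2) (Fin 2) ℝ, A.transpose = -A → hessQ W A = 0) := by
  obtain ⟨U, hUo, hU1, hU⟩ := hreg
  have hW : ContDiffAt ℝ 2 W 1 := hU.contDiffAt (hUo.mem_nhds hU1)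
  have hW1 : W 1 = 0 := hvanish 1 ⟨by simp, by simp⟩
  have hcrit : fderiv ℝ W 1 = 0 :=
    IsLocalMin.fderiv_eq_zero (Filter.Eventually.of_forall fun X => by
      rw [hW1]
      exact hWnonneg X)
  have hcurve : ∀ {γ : ℝ → Matrix (Fin 2) (Fin 2) ℝ} {V : Matrix (Fin 2) (Fin 2) ℝ},
      γ 0 = 1 → ContDiff ℝ 2 γ → HasDerivAt γ V 0 →
      iteratedDeriv 2 (fun t => W (γ t)) 0 = fderiv ℝ (fderiv ℝ W) 1 V V := by
    intro γ V h0 hγ hV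
    rw [iteratedDeriv_two_comp_of_fderiv_eq_zero (by rwa [h0]) hγ.contDiffAt (by rwa [h0]),
      hV.deriv, h0]
    rfl
  have hmain : ∀ X : Matrix (Fin 2) (Fin 2) ℝ, hessQ W X = hessQ W (symPart X) := by
    intro X
    set S := symPart X with hS
    set J := planeRotationGenerator with hJ
    set a := (X 1 0 - X 0 1) / 2 with ha
    have hX : a • J + S = X := smul_planeRotationGenerator_add_symPart X
    have hline : HasDerivAt (fun t : ℝ => 1 + t • X) X 0 := by
      have h := ((hasDerivAt_id (0 : ℝ)).smul_const X).const_add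
        (1 : Matrix (Fin 2) (Fin 2) ℝ)
      rw [one_smul] at h
      exact h
    have hcos : HasDerivAt (fun t : ℝ => Real.cos (a * t)) 0 0 := by
      simpa using ((hasDerivAt_id (0 : ℝ)).const_mul a).cos
    have hsin : HasDerivAt (fun t : ℝ => Real.sin (a * t)) a 0 := by
      simpa using ((hasDerivAt_id (0 : ℝ)).const_mul a).sin
    have htcos : HasDerivAt (fun t : ℝ => t * Real.cos (a * t)) 1 0 := by
      simpa using (hasDerivAt_id' (0 : ℝ)).fun_mul hcos
    have htsin : HasDerivAt (fun t : ℝ => t * Real.sin (a * t)) 0 0 := by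
      simpa using (hasDerivAt_id' (0 : ℝ)).fun_mul hsin
    have hrot : HasDerivAt (fun t : ℝ => Real.cos (a * t) • (1 : Matrix (Fin 2) (Fin 2) ℝ) +
        Real.sin (a * t) • J + (t * Real.cos (a * t)) • S + (t * Real.sin (a * t)) • (J * S))
        X 0 := by
      have h := (((hcos.smul_const (1 : Matrix (Fin 2) (Fin 2) ℝ)).add (hsin.smul_const J)).add
        (htcos.smul_const S)).add (htsin.smul_const (J * S))
      simp only [zero_smul, zero_add, add_zero, one_smul, hX] at h
      exact h
    have hrotW : (fun t : ℝ => W (1 + t • S)) = fun t : ℝ =>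
        W (Real.cos (a * t) • (1 : Matrix (Fin 2) (Fin 2) ℝ) +
          Real.sin (a * t) • J + (t * Real.cos (a * t)) • S + (t * Real.sin (a * t)) • (J * S)) := by
      funext t
      rw [← hframe _ (planeRotation_mem_SO2 (a * t)) (1 + t • S)]
      congr 1
      simp only [add_mul, mul_add, mul_one, one_mul, smul_mul_assoc, mul_smul_comm, ← hJ]
      module
    have hleft : hessQ W X = fderiv ℝ (fderiv ℝ W) 1 X X :=
      hcurve (by simp) (by fun_prop) hline
    rw [hleft, hessQ, hrotW]
    exact (hcurve (by simp) (by fun_prop) hrot).symm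
  exact ⟨hmain, fun A hA => by rw [hmain, symPart_eq_zero hA, hessQ_zero]⟩
end

section
/- Let W : ℝ^{2×2} → [0,∞) be C² in a neighborhood of the identity matrix with W(Id) = 0, and suppose there is c > 0 such that W(X) ≥ c·dist²(X, SO(2)) for all X ∈ ℝ^{2×2}, where dist is measured in the Frobenius norm. Let Q be the Hessian quadratic form of W at the identity, Q(X) = (d²/dt²)|_{t=0} W(Id + tX). Then Q is positive definite on symmetric matrices; more precisely, Q(S) ≥ 2c‖S‖² for every symmetric S ∈ ℝ^{2×2}, where ‖·‖ is the Frobenius norm. -/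
/-! STATEMENT 1: If `W` is C² near the identity, `W(Id) = 0` and
`W(X) ≥ c · dist²(X, SO(2))` (Frobenius distance), then the Hessian `Q` of `W` at the
identity satisfies `Q(S) ≥ 2c‖S‖²` for every symmetric `S`. -/

attribute [local instance] Matrix.frobeniusNormedAddCommGroup Matrix.frobeniusNormedSpace

/-- Second-order necessary condition for a local minimum. -/
lemma iteratedDeriv_two_nonneg_of_isLocalMin {g : ℝ → ℝ} {x : ℝ} (hmin : IsLocalMin g x)
    (hcont : ContinuousAt g x) : 0 ≤ iteratedDeriv 2 g x := by
  by_contra! hneg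
  have hsecond : iteratedDeriv 2 g x = deriv (deriv g) x := by
    rw [iteratedDeriv_succ, iteratedDeriv_one]
  have hmax : IsLocalMax g x :=
    isLocalMax_of_deriv_deriv_neg (hsecond ▸ hneg) hmin.deriv_eq_zero hcont
  have hconst : g =ᶠ[nhds x] fun _ => g x := by
    filter_upwards [hmin, hmax] with t h₁ h₂ using le_antisymm h₂ h₁
  have hzero : iteratedDeriv 2 g x = 0 := by
    rw [hconst.iteratedDeriv_eq 2, iteratedDeriv_const]
    simp
  exact hneg.ne hzero

lemma frobenius_norm_sq_fin_two (A : Matrix (Fin 2) (Fin 2) ℝ) :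
    ‖A‖ ^ 2 = A 0 0 ^ 2 + A 0 1 ^ 2 + A 1 0 ^ 2 + A 1 1 ^ 2 := by
  rw [Matrix.frobenius_norm_def, ← Real.sqrt_eq_rpow, Real.sq_sqrt (by positivity)]
  simp [Fin.sum_univ_two]
  ring

/-- Among all rotations, the identity is nearest to a symmetric matrix of nonnegative trace. -/
lemma norm_sub_one_le_infDist_SO2 {X : Matrix (Fin 2) (Fin 2) ℝ} (hX : X.transpose = X)
    (htr : 0 ≤ X 0 0 + X 1 1) : ‖X - 1‖ ≤ Metric.infDist X SO2 := by
  refine (Metric.le_infDist ⟨1, by simp [SO2]⟩).2 fun R ⟨hR, hdet⟩ => ?_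
  rw [dist_eq_norm]
  refine le_of_sq_le_sq ?_ (norm_nonneg _)
  have hsymm : X 1 0 = X 0 1 := congrFun (congrFun hX 0) 1
  have h₀ := congrFun (congrFun hR 0) 0
  have h₁ := congrFun (congrFun hR 1) 1
  simp only [Matrix.mul_apply, Matrix.transpose_apply, Fin.sum_univ_two,
    Matrix.one_apply_eq] at h₀ h₁
  rw [Matrix.det_fin_two] at hdet
  have hsq : (R 0 0 - R 1 1) ^ 2 + (R 0 1 + R 1 0) ^ 2 = 0 := by
    linear_combination h₀ + h₁ - 2 * hdet
  have hdiag : R 1 1 = R 0 0 := by nlinarith [sq_nonneg (R 0 0 - R 1 1), sq_nonneg (R 0 1 + R 1 0)]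
  have hoff : R 0 1 = -R 1 0 := by nlinarith [sq_nonneg (R 0 0 - R 1 1), sq_nonneg (R 0 1 + R 1 0)]
  have hle : R 0 0 ≤ 1 := by nlinarith [sq_nonneg (R 1 0)]
  rw [frobenius_norm_sq_fin_two, frobenius_norm_sq_fin_two]
  simp only [Matrix.sub_apply, hsymm, hdiag, hoff, Matrix.one_apply_eq, ne_eq, zero_ne_one,
    one_ne_zero, not_false_eq_true, Matrix.one_apply_ne]
  nlinarith [mul_nonneg htr (sub_nonneg.2 hle)]

theorem hessQ_pos_def_on_symmetric
    (W : Matrix (Fin 2) (Fin 2) ℝ → ℝ)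
    (hWnonneg : ∀ X, 0 ≤ W X)
    (hreg : ∃ U : Set (Matrix (Fin 2) (Fin 2) ℝ),
      IsOpen U ∧ (1 : Matrix (Fin 2) (Fin 2) ℝ) ∈ U ∧ ContDiffOn ℝ 2 W U)
    (hId : W 1 = 0)
    (c : ℝ) (hc : 0 < c)
    (hlower : ∀ X : Matrix (Fin 2) (Fin 2) ℝ, c * (Metric.infDist X SO2) ^ 2 ≤ W X) :
    ∀ S : Matrix (Fin 2) (Fin 2) ℝ, S.transpose = S →
      2 * c * ‖S‖ ^ 2 ≤ hessQ W S := by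
  intro S hS
  obtain ⟨U, hU, hmem, hW⟩ := hreg
  set f : ℝ → ℝ := fun t => W (1 + t • S) with hf
  have hf_smooth : ContDiffAt ℝ 2 f 0 := by
    have hWat : ContDiffAt ℝ 2 W (1 + (0 : ℝ) • S) := by
      simpa using hW.contDiffAt (hU.mem_nhds hmem)
    exact hWat.comp (0 : ℝ) (contDiffAt_const.add (contDiffAt_id.smul contDiffAt_const))
  set q : ℝ → ℝ := fun t => c * ‖S‖ ^ 2 * t ^ 2 with hq
  have hq_smooth : ContDiffAt ℝ 2 q 0 := by fun_prop
  have hq_second : iteratedDeriv 2 q 0 = 2 * c * ‖S‖ ^ 2 := by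
    rw [iteratedDeriv_succ, iteratedDeriv_one]
    have hderiv : deriv q = fun t => c * ‖S‖ ^ 2 * (2 * t) := by
      funext t
      simp [hq]
    rw [hderiv]
    simp
    ring
  have hmin : IsLocalMin (f - q) 0 := by
    have hcont : Continuous fun t : ℝ => (2 : ℝ) + t * (S 0 0 + S 1 1) := by fun_prop
    have hpos : ∀ᶠ t in nhds (0 : ℝ), 0 < 2 + t * (S 0 0 + S 1 1) :=
      hcont.continuousAt.eventually_const_lt (by simp)
    filter_upwards [hpos] with t ht
    have hdist := norm_sub_one_le_infDist_SO2 (X := 1 + t • S)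
      (by simp [Matrix.transpose_add, Matrix.transpose_smul, hS])
      (by simp only [Matrix.add_apply, Matrix.smul_apply, Matrix.one_apply_eq, smul_eq_mul]
          linarith)
    rw [add_sub_cancel_left, norm_smul] at hdist
    have hsq := pow_le_pow_left₀ (by positivity) hdist 2
    rw [mul_pow, Real.norm_eq_abs, sq_abs] at hsq
    have hbound := (mul_le_mul_of_nonneg_left hsq hc.le).trans (hlower (1 + t • S))
    simp only [Pi.sub_apply, hf, hq, zero_smul, add_zero, hId]
    nlinarith
  have hnonneg := iteratedDeriv_two_nonneg_of_isLocalMin hmin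
    (hf_smooth.sub hq_smooth).continuousAt
  rw [iteratedDeriv_sub hf_smooth hq_smooth, hq_second] at hnonneg
  exact sub_nonneg.1 hnonneg
end

section
/- Let Q : ℝ^{2×2} → ℝ be a quadratic form (i.e. Q(X) = B(X,X) for a symmetric bilinear form B) such that Q(X) = Q(sym X) for all X and Q(S) > 0 for every nonzero symmetric S ∈ ℝ^{2×2}. Then: (a) the function γ ↦ Q(e₁⊗e₁ + γ⊗e₂) on ℝ² attains its minimum at a unique point γ* ∈ ℝ²; (b) α := Q(e₁⊗e₁ + γ*⊗e₂) > 0; (c) for every λ ∈ ℝ, the function γ ↦ Q(λ e₁⊗e₁ + γ⊗e₂) attains its minimum at the unique point λγ*, and the minimum value equals α·λ²; (d) min_{γ∈ℝ²} Q(e₁⊗e₁ + γ⊗e₂) = min_{γ∈ℝ²} Q(e₁⊗e₁ + (γ⊗e₂ + e₂⊗γ)/2). -/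
/-- `e₁ = (1,0)ᵀ`. -/
def e1 : Fin 2 → ℝ := ![1, 0]

/-- `e₂ = (0,1)ᵀ`. -/
def e2 : Fin 2 → ℝ := ![0, 1]

/-- If a bilinear form is positive definite along the range of `F`, then every affine translate
of that range contains a vector which the form makes orthogonal to the range. -/
theorem exists_add_orthogonal_range {V M : Type*} [AddCommGroup V] [Module ℝ V]
    [FiniteDimensional ℝ V] [AddCommGroup M] [Module ℝ M] (β : M →ₗ[ℝ] M →ₗ[ℝ] ℝ)
    (F : V →ₗ[ℝ] M) (hpos : ∀ u, u ≠ 0 → 0 < β (F u) (F u)) (E : M) :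
    ∃ g, ∀ u, β (E + F g) (F u) = 0 := by
  have hinj : Function.Injective (β.compl₁₂ F F) := by
    refine (injective_iff_map_eq_zero _).2 fun u hu => ?_
    by_contra hne
    exact (hpos u hne).ne' (by simpa using LinearMap.congr_fun hu u)
  have hsurj : Function.Surjective (β.compl₁₂ F F) :=
    (LinearMap.injective_iff_surjective_of_finrank_eq_finrank
      (Subspace.dual_finrank_eq (K := ℝ) (V := V)).symm).1 hinj
  obtain ⟨g, hg⟩ := hsurj (-(β E ∘ₗ F))
  refine ⟨g, fun u => ?_⟩
  have := LinearMap.congr_fun hg u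
  simp only [LinearMap.compl₁₂_apply, LinearMap.neg_apply, LinearMap.comp_apply] at this
  simp [this]

/-- The linear map `γ ↦ γ ⊗ e₂`. -/
def tensorE2 : (Fin 2 → ℝ) →ₗ[ℝ] Matrix (Fin 2) (Fin 2) ℝ where
  toFun γ := Matrix.vecMulVec γ e2
  map_add' _ _ := Matrix.add_vecMulVec _ _ _
  map_smul' _ _ := Matrix.smul_vecMulVec _ _ _

theorem symPart_transpose (X : Matrix (Fin 2) (Fin 2) ℝ) :
    (symPart X).transpose = symPart X := by
  simp [symPart, add_comm]

theorem symPart_add_tensorE2 (γ : Fin 2 → ℝ) :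
    symPart (Matrix.vecMulVec e1 e1 + Matrix.vecMulVec γ e2) =
      Matrix.vecMulVec e1 e1 +
        (2⁻¹ : ℝ) • (Matrix.vecMulVec γ e2 + Matrix.vecMulVec e2 γ) := by
  simp only [symPart, Matrix.transpose_add, Matrix.transpose_vecMulVec]
  module

theorem symPart_tensorE2_ne_zero {u : Fin 2 → ℝ} (hu : u ≠ 0) :
    symPart (tensorE2 u) ≠ 0 := by
  refine fun h => hu ?_
  have h0 := congrFun (congrFun h 0) 1
  have h1 := congrFun (congrFun h 1) 1
  simp [symPart, tensorE2, e2] at h0 h1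
  ext i
  fin_cases i <;> simp_all

theorem symPart_add_tensorE2_ne_zero (γ : Fin 2 → ℝ) :
    symPart (Matrix.vecMulVec e1 e1 + tensorE2 γ) ≠ 0 := by
  intro h
  have h0 := congrFun (congrFun h 0) 0
  simp [symPart, tensorE2, e1, e2] at h0

theorem quadratic_form_relaxation
    (Q : Matrix (Fin 2) (Fin 2) ℝ → ℝ)
    (B : Matrix (Fin 2) (Fin 2) ℝ → Matrix (Fin 2) (Fin 2) ℝ → ℝ)
    (hBlin : ∀ Y, IsLinearMap ℝ (fun X => B X Y))
    (hBsymm : ∀ X Y, B X Y = B Y X)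
    (hQB : ∀ X, Q X = B X X)
    (hQsym : ∀ X, Q X = Q (symPart X))
    (hQpos : ∀ S : Matrix (Fin 2) (Fin 2) ℝ, S.transpose = S → S ≠ 0 → 0 < Q S) :
    ∃ (γstar : Fin 2 → ℝ) (α : ℝ),
      -- (a) the minimum is attained at γ*, and γ* is the unique minimizer
      IsLeast {v : ℝ | ∃ γ : Fin 2 → ℝ,
        v = Q (Matrix.vecMulVec e1 e1 + Matrix.vecMulVec γ e2)} α ∧
      α = Q (Matrix.vecMulVec e1 e1 + Matrix.vecMulVec γstar e2) ∧
      (∀ γ : Fin 2 → ℝ,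
        Q (Matrix.vecMulVec e1 e1 + Matrix.vecMulVec γ e2) = α → γ = γstar) ∧
      -- (b) α > 0
      0 < α ∧
      -- (c) for every λ, the unique minimizer is λγ* with minimum value αλ²
      (∀ lam : ℝ,
        IsLeast {v : ℝ | ∃ γ : Fin 2 → ℝ,
          v = Q (lam • Matrix.vecMulVec e1 e1 + Matrix.vecMulVec γ e2)} (α * lam ^ 2) ∧
        Q (lam • Matrix.vecMulVec e1 e1 + Matrix.vecMulVec (lam • γstar) e2) = α * lam ^ 2 ∧
        (∀ γ : Fin 2 → ℝ,
          Q (lam • Matrix.vecMulVec e1 e1 + Matrix.vecMulVec γ e2) = α * lam ^ 2 →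
            γ = lam • γstar)) ∧
      -- (d) the two minima agree
      IsLeast {v : ℝ | ∃ γ : Fin 2 → ℝ,
        v = Q (Matrix.vecMulVec e1 e1 +
          (2⁻¹ : ℝ) • (Matrix.vecMulVec γ e2 + Matrix.vecMulVec e2 γ))} α := by
  let β : Matrix (Fin 2) (Fin 2) ℝ →ₗ[ℝ] Matrix (Fin 2) (Fin 2) ℝ →ₗ[ℝ] ℝ :=
    LinearMap.mk₂ ℝ B (fun X X' Y => (hBlin Y).map_add X X')
      (fun c X Y => (hBlin Y).map_smul c X)
      (fun X Y Y' => by simpa only [hBsymm X] using (hBlin X).map_add Y Y')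
      (fun c X Y => by simpa only [hBsymm X] using (hBlin X).map_smul c Y)
  have hQβ : ∀ X, Q X = β X X := hQB
  have hβsymm : ∀ X Y, β X Y = β Y X := hBsymm
  have hpos : ∀ X, symPart X ≠ 0 → 0 < Q X := fun X hX => by
    rw [hQsym]
    exact hQpos _ (symPart_transpose X) hX
  have hFpos : ∀ u, u ≠ 0 → 0 < Q (tensorE2 u) := fun u hu =>
    hpos _ (symPart_tensorE2_ne_zero hu)
  obtain ⟨g, hg⟩ := exists_add_orthogonal_range β tensorE2
    (fun u hu => by simpa only [← hQβ] using hFpos u hu) (Matrix.vecMulVec e1 e1)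
  set α := Q (Matrix.vecMulVec e1 e1 + Matrix.vecMulVec g e2) with hα
  have hsplit : ∀ (lam : ℝ) (γ : Fin 2 → ℝ),
      Q (lam • Matrix.vecMulVec e1 e1 + Matrix.vecMulVec γ e2) =
        α * lam ^ 2 + Q (tensorE2 (γ - lam • g)) := fun lam γ => by
    have hdecomp : lam • Matrix.vecMulVec e1 e1 + Matrix.vecMulVec γ e2 =
        lam • (Matrix.vecMulVec e1 e1 + tensorE2 g) + tensorE2 (γ - lam • g) := by
      change _ + tensorE2 γ = _
      rw [map_sub, map_smul]
      module
    have hα' : α = β (Matrix.vecMulVec e1 e1 + tensorE2 g)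
        (Matrix.vecMulVec e1 e1 + tensorE2 g) := hQβ _
    have horth := hg (γ - lam • g)
    have horth' := (hβsymm _ _).trans horth
    rw [hdecomp, hQβ, hQβ (tensorE2 _), hα']
    generalize Matrix.vecMulVec e1 e1 + tensorE2 g = X at *
    generalize tensorE2 (γ - lam • g) = Y at *
    simp only [map_add, map_smul, LinearMap.add_apply, LinearMap.smul_apply, smul_eq_mul,
      horth, horth']
    ring
  have hQ0 : Q 0 = 0 := by simp [hQβ]
  have hFnonneg : ∀ u, 0 ≤ Q (tensorE2 u) := fun u => by
    rcases eq_or_ne u 0 with rfl | hu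
    · simp [hQ0]
    · exact (hFpos u hu).le
  have hmin : ∀ lam : ℝ,
      IsLeast {v : ℝ | ∃ γ : Fin 2 → ℝ,
        v = Q (lam • Matrix.vecMulVec e1 e1 + Matrix.vecMulVec γ e2)} (α * lam ^ 2) ∧
      Q (lam • Matrix.vecMulVec e1 e1 + Matrix.vecMulVec (lam • g) e2) = α * lam ^ 2 ∧
      (∀ γ : Fin 2 → ℝ,
        Q (lam • Matrix.vecMulVec e1 e1 + Matrix.vecMulVec γ e2) = α * lam ^ 2 →
          γ = lam • g) := fun lam => by
    have hval : Q (lam • Matrix.vecMulVec e1 e1 + Matrix.vecMulVec (lam • g) e2) =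
        α * lam ^ 2 := by
      rw [hsplit, sub_self, map_zero, hQ0, add_zero]
    refine ⟨⟨⟨lam • g, hval.symm⟩, ?_⟩, hval, fun γ hγ => ?_⟩
    · rintro _ ⟨γ, rfl⟩
      rw [hsplit]
      exact le_add_of_nonneg_right (hFnonneg _)
    · rw [hsplit, add_eq_left] at hγ
      by_contra hne
      exact (hFpos _ (sub_ne_zero.2 hne)).ne' hγ
  have hmin_one := hmin 1
  simp only [one_smul, one_pow, mul_one] at hmin_one
  refine ⟨g, α, hmin_one.1, hα, hmin_one.2.2, hpos _ (symPart_add_tensorE2_ne_zero g), hmin, ?_⟩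
  simpa only [← symPart_add_tensorE2, ← hQsym] using hmin_one.1
end

section
/- For every m > 0 there exists a constant C = C(m) > 0 with the following property. Let Q = (0,2) × (−1/2, 1/2) ⊂ ℝ² and let V ⊆ Q be a Lebesgue measurable set with |V| ≥ m. Then for every matrix A ∈ ℝ^{2×2} and every vector b ∈ ℝ², sup_{x ∈ Q} |Ax + b|² + ‖A‖² ≤ C ∫_V |Ax + b|² dx. (In particular, two affine maps r₁(x) = R₁x + c₁ and r₂(x) = R₂x + c₂ that are L²-close on a subset of Q of measure at least m satisfy ‖r₁ − r₂‖_{L^∞(Q)}² + ‖R₁ − R₂‖² ≤ C‖r₁ − r₂‖²_{L²(V)}.) -/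
open MeasureTheory

/-! STATEMENT 4: For every `m > 0` there is `C = C(m) > 0` such that for the rectangle
`Q = (0,2) × (−1/2,1/2)`, every measurable `V ⊆ Q` with `|V| ≥ m`, every matrix `A` and
vector `b`: `sup_{x∈Q} |Ax+b|² + ‖A‖² ≤ C ∫_V |Ax+b|² dx` (stated pointwise in `x ∈ Q`). -/

/-- Squared Euclidean norm of a vector in ℝ². -/
def sqnorm2 (v : Fin 2 → ℝ) : ℝ := v 0 ^ 2 + v 1 ^ 2

/-- Squared Frobenius norm of a 2×2 matrix. -/
def frobSq (A : Matrix (Fin 2) (Fin 2) ℝ) : ℝ := ∑ i, ∑ j, (A i j) ^ 2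

/-- The rectangle `Q = (0,2) × (−1/2, 1/2)` in ℝ². -/
def rectQ : Set (Fin 2 → ℝ) :=
  {x | x 0 ∈ Set.Ioo (0 : ℝ) 2 ∧ x 1 ∈ Set.Ioo (-(1 / 2) : ℝ) (1 / 2)}

lemma rectQ_subset_Icc : rectQ ⊆ Set.Icc ![0, -(1 / 2)] ![2, 1 / 2] := by
  rintro x ⟨⟨h1, h2⟩, h3, h4⟩
  constructor <;> intro i <;> fin_cases i <;> simp at * <;> linarith

lemma volume_rectQ_lt_top : volume rectQ < ⊤ :=
  (measure_mono rectQ_subset_Icc).trans_lt isCompact_Icc.measure_lt_top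

/-- A set contained in the preimage of a box under an invertible linear map has measure at most
the area of the box divided by the absolute value of the determinant. -/
lemma volumeReal_le_of_subset_preimage_Icc {S : Set (Fin 2 → ℝ)}
    (M : Matrix (Fin 2) (Fin 2) ℝ) (hM : M.det ≠ 0) {l u : Fin 2 → ℝ} (hlu : l ≤ u)
    (hS : ∀ y ∈ S, M.mulVec y ∈ Set.Icc l u) :
    volume.real S ≤ |M.det|⁻¹ * ((u 0 - l 0) * (u 1 - l 1)) := by
  have hdet : LinearMap.det (Matrix.toLin' M) ≠ 0 := by rwa [LinearMap.det_toLin']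
  have hvol : volume (Matrix.toLin' M ⁻¹' Set.Icc l u)
      = ENNReal.ofReal (|M.det|⁻¹ * ((u 0 - l 0) * (u 1 - l 1))) := by
    rw [Measure.addHaar_preimage_linearMap _ hdet, Real.volume_Icc_pi, Fin.prod_univ_two,
      LinearMap.det_toLin', abs_inv, ENNReal.ofReal_mul (by positivity),
      ENNReal.ofReal_mul (sub_nonneg.2 (hlu 0))]
  refine ENNReal.toReal_le_of_le_ofReal ?_ ((measure_mono fun y hy => ?_).trans hvol.le)
  · exact mul_nonneg (by positivity)
      (mul_nonneg (sub_nonneg.2 (hlu 0)) (sub_nonneg.2 (hlu 1)))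
  · simpa using hS y hy

lemma volumeReal_rectQ_inter_slab_le (p q c : ℝ) {δ : ℝ} (hδ : 0 < δ) (hδ' : δ ≤ 1 / 8)
    (hs : 0 < |p| + |q| + |c|) :
    volume.real (rectQ ∩ {y | |p * y 0 + q * y 1 + c| ≤ δ * (|p| + |q| + |c|)}) ≤ 32 * δ := by
  set s := |p| + |q| + |c|
  have ht : 0 < δ * s := mul_pos hδ hs
  by_cases hp : s ≤ 8 * |p|
  · have hp0 : 0 < |p| := by linarith
    refine (volumeReal_le_of_subset_preimage_Icc !![p, q; 0, 1] ?_
      (l := ![-(δ * s) - c, -(1 / 2)]) (u := ![δ * s - c, 1 / 2]) ?_ ?_).trans ?_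
    · simpa using abs_pos.1 hp0
    · intro i; fin_cases i <;> simp; linarith
    · rintro y ⟨⟨⟨h1, h2⟩, h3, h4⟩, h5⟩
      have h5 := abs_le.1 (Set.mem_ofPred.1 h5)
      constructor <;> intro i <;> fin_cases i <;> simp [Matrix.mulVec, dotProduct] at * <;>
        linarith
    · simp only [Matrix.det_fin_two_of, Matrix.cons_val_zero, Matrix.cons_val_one]
      rw [inv_mul_le_iff₀ (by simpa using hp0)]
      simp only [mul_one, mul_zero, sub_zero]
      nlinarith
  by_cases hq : s ≤ 8 * |q|
  · have hq0 : 0 < |q| := by linarith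
    refine (volumeReal_le_of_subset_preimage_Icc !![1, 0; p, q] ?_
      (l := ![0, -(δ * s) - c]) (u := ![2, δ * s - c]) ?_ ?_).trans ?_
    · simpa using abs_pos.1 hq0
    · intro i; fin_cases i <;> simp; linarith
    · rintro y ⟨⟨⟨h1, h2⟩, h3, h4⟩, h5⟩
      have h5 := abs_le.1 (Set.mem_ofPred.1 h5)
      constructor <;> intro i <;> fin_cases i <;> simp [Matrix.mulVec, dotProduct] at * <;>
        linarith
    · simp only [Matrix.det_fin_two_of, Matrix.cons_val_zero, Matrix.cons_val_one]
      rw [inv_mul_le_iff₀ (by simpa using hq0)]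
      simp only [one_mul, zero_mul, sub_zero]
      nlinarith
  · have hempty : rectQ ∩ {y | |p * y 0 + q * y 1 + c| ≤ δ * s} = ∅ := by
      refine Set.eq_empty_of_forall_notMem ?_
      rintro y ⟨⟨⟨h1, h2⟩, h3, h4⟩, h5⟩
      have h5 : |p * y 0 + q * y 1 + c| ≤ δ * s := h5
      have hpy : |p * y 0| ≤ |p| * 2 := by
        rw [abs_mul]; gcongr; rw [abs_le]; constructor <;> linarith
      have hqy : |q * y 1| ≤ |q| * (1 / 2) := by
        rw [abs_mul]; gcongr; rw [abs_le]; constructor <;> linarith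
      have hc : |c| ≤ |p * y 0 + q * y 1 + c| + |p * y 0| + |q * y 1| := by
        have h := abs_sub (p * y 0 + q * y 1 + c) (p * y 0 + q * y 1)
        rw [add_sub_cancel_left] at h
        linarith [abs_add_le (p * y 0) (q * y 1)]
      have : δ * s ≤ 1 / 8 * s := by gcongr
      linarith
    rw [hempty, measureReal_empty]
    positivity

lemma integrableOn_affine_sq {V : Set (Fin 2 → ℝ)} (hVQ : V ⊆ rectQ) (p q c : ℝ) :
    IntegrableOn (fun y : Fin 2 → ℝ => (p * y 0 + q * y 1 + c) ^ 2) V := by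
  have hf : Continuous fun y : Fin 2 → ℝ => (p * y 0 + q * y 1 + c) ^ 2 := by fun_prop
  exact hf.integrableOn_Icc.mono_set (hVQ.trans rectQ_subset_Icc)

lemma affine_coeff_sq_le_setIntegral {m δ : ℝ} (hm : 0 < m) (hδ : 0 < δ) (hδ' : δ ≤ 1 / 8)
    (hδm : 64 * δ ≤ m) {V : Set (Fin 2 → ℝ)} (hV : MeasurableSet V) (hVQ : V ⊆ rectQ)
    (hmV : ENNReal.ofReal m ≤ volume V) (p q c : ℝ) :
    δ ^ 2 * (m / 2) * (p ^ 2 + q ^ 2 + c ^ 2) ≤ ∫ y in V, (p * y 0 + q * y 1 + c) ^ 2 := by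
  have hnn : 0 ≤ ∫ y in V, (p * y 0 + q * y 1 + c) ^ 2 := integral_nonneg fun y => sq_nonneg _
  have hsq : p ^ 2 + q ^ 2 + c ^ 2 ≤ (|p| + |q| + |c|) ^ 2 := by
    rw [← sq_abs p, ← sq_abs q, ← sq_abs c]
    nlinarith [mul_nonneg (abs_nonneg p) (abs_nonneg q), mul_nonneg (abs_nonneg p) (abs_nonneg c),
      mul_nonneg (abs_nonneg q) (abs_nonneg c)]
  rcases (by positivity : 0 ≤ |p| + |q| + |c|).eq_or_lt with h0 | hs
  · rw [← h0] at hsq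
    have : δ ^ 2 * (m / 2) * (p ^ 2 + q ^ 2 + c ^ 2) ≤ δ ^ 2 * (m / 2) * 0 ^ 2 := by gcongr
    linarith
  have hslab := volumeReal_rectQ_inter_slab_le p q c hδ hδ' hs
  set s := |p| + |q| + |c|
  have hVtop : volume V ≠ ⊤ := ((measure_mono hVQ).trans_lt volume_rectQ_lt_top).ne
  have hmV' : m ≤ volume.real V := (ENNReal.ofReal_le_iff_le_toReal hVtop).1 hmV
  have hcheb := mul_meas_ge_le_integral_of_nonneg
    (Filter.Eventually.of_forall fun y : Fin 2 → ℝ => sq_nonneg (p * y 0 + q * y 1 + c))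
    (integrableOn_affine_sq hVQ p q c) ((δ * s) ^ 2)
  set T := {y : Fin 2 → ℝ | (δ * s) ^ 2 ≤ (p * y 0 + q * y 1 + c) ^ 2}
  have hT : m / 2 ≤ (volume.restrict V).real T := by
    rw [measureReal_restrict_apply' hV]
    have hcover : V ⊆ (T ∩ V) ∪ (rectQ ∩ {y | |p * y 0 + q * y 1 + c| ≤ δ * s}) := by
      intro y hy
      rcases le_total (δ * s) |p * y 0 + q * y 1 + c| with h | h
      · refine Or.inl ⟨?_, hy⟩
        have := pow_le_pow_left₀ (mul_pos hδ hs).le h 2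
        rwa [sq_abs] at this
      · exact Or.inr ⟨hVQ hy, h⟩
    have hle := measureReal_mono (μ := volume) hcover (((measure_union_lt_top
      ((measure_mono Set.inter_subset_right).trans_lt hVtop.lt_top)
      ((measure_mono Set.inter_subset_left).trans_lt volume_rectQ_lt_top)).ne))
    have := measureReal_union_le (μ := volume) (T ∩ V)
      (rectQ ∩ {y | |p * y 0 + q * y 1 + c| ≤ δ * s})
    linarith
  calc δ ^ 2 * (m / 2) * (p ^ 2 + q ^ 2 + c ^ 2) ≤ δ ^ 2 * (m / 2) * s ^ 2 := by gcongr
    _ = (δ * s) ^ 2 * (m / 2) := by ring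
    _ ≤ (δ * s) ^ 2 * (volume.restrict V).real T := by gcongr
    _ ≤ _ := hcheb

lemma affine_sq_add_coeff_sq_le {x : Fin 2 → ℝ} (hx : x ∈ rectQ) (p q c : ℝ) :
    (p * x 0 + q * x 1 + c) ^ 2 + (p ^ 2 + q ^ 2) ≤ 7 * (p ^ 2 + q ^ 2 + c ^ 2) := by
  obtain ⟨⟨h1, h2⟩, h3, h4⟩ := hx
  have hx0 : x 0 ^ 2 ≤ 4 := by nlinarith
  have hx1 : x 1 ^ 2 ≤ 1 := by nlinarith
  have hcs : (p * x 0 + q * x 1 + c) ^ 2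
      ≤ (p ^ 2 + q ^ 2 + c ^ 2) * (x 0 ^ 2 + x 1 ^ 2 + 1) := by
    nlinarith [sq_nonneg (p * x 1 - q * x 0), sq_nonneg (p - c * x 0), sq_nonneg (q - c * x 1)]
  have : (p ^ 2 + q ^ 2 + c ^ 2) * (x 0 ^ 2 + x 1 ^ 2 + 1) ≤ (p ^ 2 + q ^ 2 + c ^ 2) * 6 := by
    gcongr; linarith
  linarith [sq_nonneg c]

lemma sqnorm2_mulVec_add (A : Matrix (Fin 2) (Fin 2) ℝ) (b y : Fin 2 → ℝ) :
    sqnorm2 (A.mulVec y + b) =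
      (A 0 0 * y 0 + A 0 1 * y 1 + b 0) ^ 2 + (A 1 0 * y 0 + A 1 1 * y 1 + b 1) ^ 2 := by
  simp [sqnorm2, Matrix.mulVec_eq_sum, mul_comm]

theorem affine_rigidity_on_subsets_of_rectangle (m : ℝ) (hm : 0 < m) :
    ∃ C : ℝ, 0 < C ∧
      ∀ V : Set (Fin 2 → ℝ), MeasurableSet V → V ⊆ rectQ →
        ENNReal.ofReal m ≤ volume V →
        ∀ (A : Matrix (Fin 2) (Fin 2) ℝ) (b : Fin 2 → ℝ),
          ∀ x ∈ rectQ,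
            sqnorm2 (A.mulVec x + b) + frobSq A ≤
              C * ∫ y in V, sqnorm2 (A.mulVec y + b) := by
  obtain ⟨δ, hδ, hδ', hδm⟩ : ∃ δ : ℝ, 0 < δ ∧ δ ≤ 1 / 8 ∧ 64 * δ ≤ m :=
    ⟨min (1 / 8) (m / 64), by positivity, min_le_left _ _, by
      linarith [min_le_right (1 / 8) (m / 64)]⟩
  have hK : 0 < δ ^ 2 * (m / 2) := by positivity
  refine ⟨7 / (δ ^ 2 * (m / 2)), by positivity, fun V hV hVQ hmV A b x hx => ?_⟩
  simp only [sqnorm2_mulVec_add]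
  rw [integral_add (integrableOn_affine_sq hVQ _ _ _) (integrableOn_affine_sq hVQ _ _ _),
    div_mul_eq_mul_div, le_div_iff₀ hK]
  have hrow (i : Fin 2) :=
    affine_coeff_sq_le_setIntegral hm hδ hδ' hδm hV hVQ hmV (A i 0) (A i 1) (b i)
  have hpt (i : Fin 2) := mul_le_mul_of_nonneg_right
    (affine_sq_add_coeff_sq_le hx (A i 0) (A i 1) (b i)) hK.le
  simp only [frobSq, Fin.sum_univ_two]
  linarith [hrow 0, hrow 1, hpt 0, hpt 1]
end

section
/- Let W : ℝ^{2×2} → [0,∞) be continuous, C³ in a neighborhood of SO(2), frame indifferent (W(RX) = W(X) for all R ∈ SO(2), X ∈ ℝ^{2×2}), with W(X) = 0 exactly for X ∈ SO(2) and W(X) ≥ c·dist²(X, SO(2)) for some c > 0. Let Q be the Hessian of W at the identity, Q(X) = (d²/dt²)|_{t=0} W(Id + tX). Then there exist ε₀ > 0 and C > 0 such that for every F ∈ ℝ^{2×2} and every R ∈ SO(2) with ‖RᵀF − Id‖ ≤ ε₀, one has |W(F) − (1/2)·Q(sym(RᵀF) − Id)| ≤ C‖RᵀF − Id‖³. -/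
/-! STATEMENT 6: Under the standing assumptions on the stored energy function `W`
(continuity, C³ near SO(2), frame indifference, non-degeneracy), there are `ε₀ > 0` and
`C > 0` such that for `F` and `R ∈ SO(2)` with `‖RᵀF − Id‖ ≤ ε₀`:
`|W(F) − (1/2)Q(sym(RᵀF) − Id)| ≤ C‖RᵀF − Id‖³`. -/

attribute [local instance] Matrix.frobeniusNormedAddCommGroup Matrix.frobeniusNormedSpace

section

open Set Filter Topology

variable {E : Type*} [NormedAddCommGroup E] [NormedSpace ℝ E]

theorem iteratedDeriv_comp_smul_eq_iteratedFDeriv {V : E → ℝ} {s : Set E} {n : ℕ}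
    (hs : IsOpen s) (hV : ContDiffOn ℝ n V s) (x : E) {t : ℝ} (ht : t • x ∈ s) {i : ℕ}
    (hi : i ≤ n) :
    iteratedDeriv i (fun τ : ℝ => V (τ • x)) t = iteratedFDeriv ℝ i V (t • x) fun _ => x := by
  set g : ℝ →L[ℝ] E := ContinuousLinearMap.toSpanSingleton ℝ x with hg
  have hgo : IsOpen (g ⁻¹' s) := hs.preimage g.continuous
  have hgt : g t ∈ s := by simpa [hg] using ht
  have key := g.iteratedFDerivWithin_comp_right hV hs.uniqueDiffOn hgo.uniqueDiffOn hgt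
    (i := i) (by exact_mod_cast hi)
  rw [iteratedFDerivWithin_of_isOpen i hgo hgt, iteratedFDerivWithin_of_isOpen i hs hgt] at key
  have hfun : (fun τ : ℝ => V (τ • x)) = V ∘ g := by
    ext τ; simp [hg]
  rw [iteratedDeriv_eq_iteratedFDeriv, hfun, key]
  simp [hg]

theorem exists_abs_sub_half_hessian_le {V : E → ℝ} (hV : ContDiffAt ℝ 3 V 0) (h0 : V 0 = 0)
    (hmin : IsLocalMin V 0) :
    ∃ r M : ℝ, 0 < r ∧ 0 < M ∧ (∀ x : E, iteratedDeriv 2 (fun τ : ℝ => V (τ • x)) 0 =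
        fderiv ℝ (fderiv ℝ V) 0 x x) ∧ ∀ x : E, ‖x‖ < r →
      |V x - 1 / 2 * fderiv ℝ (fderiv ℝ V) 0 x x| ≤ M * ‖x‖ ^ 3 := by
  obtain ⟨u, hu, hVu⟩ := hV.contDiffOn (m := 3) le_rfl (by simp)
  have hcont : ContinuousAt (iteratedFDeriv ℝ 3 V) 0 :=
    (hV.iteratedFDeriv_right (m := 0) (i := 3) (by norm_num)).continuousAt
  set M := ‖iteratedFDeriv ℝ 3 V 0‖ + 1 with hM
  have hMpos : 0 < M := by positivity
  have hbd : ∀ᶠ y in 𝓝 (0 : E), ‖iteratedFDeriv ℝ 3 V y‖ < M :=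
    hcont.norm.eventually_lt_const (by simp [hM])
  obtain ⟨r, hr, hball⟩ := Metric.eventually_nhds_iff_ball.1 (hbd.and hu)
  have hVb : ContDiffOn ℝ (3 : ℕ) V (Metric.ball 0 r) := hVu.mono fun y hy => (hball y hy).2
  have hderiv : ∀ (i : ℕ), i ≤ 3 → ∀ (x : E) (t : ℝ), t • x ∈ Metric.ball (0 : E) r →
      iteratedDeriv i (fun τ : ℝ => V (τ • x)) t = iteratedFDeriv ℝ i V (t • x) fun _ => x :=
    fun i hi x t ht =>
      iteratedDeriv_comp_smul_eq_iteratedFDeriv Metric.isOpen_ball hVb x ht hi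
  have h2 : ∀ x : E, iteratedDeriv 2 (fun τ : ℝ => V (τ • x)) 0 =
      fderiv ℝ (fderiv ℝ V) 0 x x := fun x => by
    rw [hderiv 2 (by norm_num) x 0 (by simpa using hr), iteratedFDeriv_two_apply, zero_smul]
  refine ⟨r, M, hr, hMpos, h2, fun x hx => ?_⟩
  have hmem : ∀ t ∈ Icc (0 : ℝ) 1, t • x ∈ Metric.ball (0 : E) r := fun t ht => by
    rw [mem_ball_zero_iff, norm_smul, Real.norm_of_nonneg ht.1]
    nlinarith [norm_nonneg x, ht.1, ht.2]
  have hgc : ∀ t ∈ Icc (0 : ℝ) 1, ContDiffAt ℝ (3 : ℕ) (fun τ : ℝ => V (τ • x)) t :=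
    fun t ht => ((hVb.contDiffAt (Metric.isOpen_ball.mem_nhds (hmem t ht))).comp t
      (contDiffAt_id.smul contDiffAt_const))
  obtain ⟨ξ, hξ, heq⟩ := taylor_mean_remainder_lagrange_iteratedDeriv
    (f := fun τ : ℝ => V (τ • x)) (x := 1) (x₀ := 0) (n := 2) (by norm_num)
    (fun t ht => (hgc t (by simpa using ht)).contDiffWithinAt)
  have hξ' : ξ ∈ Icc (0 : ℝ) 1 := by
    rw [uIoo_of_le zero_le_one] at hξ
    exact Ioo_subset_Icc_self hξ
  have hw : ∀ i : ℕ, i ≤ 3 → iteratedDerivWithin i (fun τ : ℝ => V (τ • x)) (uIcc 0 1) 0 =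
      iteratedDeriv i (fun τ : ℝ => V (τ • x)) 0 := fun i hi =>
    iteratedDerivWithin_eq_iteratedDeriv (by simpa using uniqueDiffOn_Icc_zero_one)
      ((hgc 0 (by simp)).of_le (by exact_mod_cast hi)) (by simp)
  have h1 : iteratedDeriv 1 (fun τ : ℝ => V (τ • x)) 0 = 0 := by
    rw [hderiv 1 (by norm_num) x 0 (by simpa using hr), iteratedFDeriv_one_apply, zero_smul,
      hmin.fderiv_eq_zero]
    simp
  have hrem : |V x - 1 / 2 * fderiv ℝ (fderiv ℝ V) 0 x x| =
      |iteratedFDeriv ℝ 3 V (ξ • x) fun _ => x| / 6 := by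
    rw [taylor_within_apply] at heq
    simp only [Finset.sum_range_succ, Finset.sum_range_zero] at heq
    rw [hw 0 (by norm_num), hw 1 (by norm_num), hw 2 (by norm_num), h1, h2,
      iteratedDeriv_zero, hderiv 3 le_rfl x ξ (hmem ξ hξ')] at heq
    norm_num [h0, Nat.factorial] at heq
    rw [heq, abs_div, abs_of_pos (by norm_num : (0 : ℝ) < 6)]
  have hop := (iteratedFDeriv ℝ 3 V (ξ • x)).le_opNorm fun _ => x
  simp only [Finset.prod_const, Finset.card_univ, Fintype.card_fin, Real.norm_eq_abs] at hop
  have hξM := (hball _ (hmem ξ hξ')).1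
  rw [hrem]
  nlinarith [mul_le_mul_of_nonneg_right hξM.le (pow_nonneg (norm_nonneg x) 3),
    mul_nonneg hMpos.le (pow_nonneg (norm_nonneg x) 3)]

theorem ContinuousLinearMap.apply_add_self_of_apply_self_eq_zero (B : E →L[ℝ] E →L[ℝ] ℝ)
    (hB : ∀ x, 0 ≤ B x x) (x : E) {y : E} (hy : B y y = 0) : B (x + y) (x + y) = B x x := by
  have h : ∀ t : ℝ, 0 ≤ B x x + t * (B x y + B y x) := fun t => by
    have := hB (x + t • y)
    simp [hy] at this
    linarith
  have hc : B x y + B y x = 0 := by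
    by_contra hne
    have := h (-(B x x + 1) / (B x y + B y x))
    rw [div_mul_cancel₀ _ hne] at this
    linarith
  simp [hy]
  linarith

theorem nonpos_of_forall_mul_sq_le {b K δ : ℝ} (hδ : 0 < δ)
    (h : ∀ t, 0 < t → t < δ → b * t ^ 2 ≤ K * t ^ 3) : b ≤ 0 := by
  have hlim : Tendsto (fun t : ℝ => K * t) (𝓝[>] 0) (𝓝 0) := by
    have : Tendsto (fun t : ℝ => K * t) (𝓝 0) (𝓝 (K * 0)) := tendsto_id.const_mul K
    simpa using this.mono_left nhdsWithin_le_nhds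
  refine ge_of_tendsto hlim ?_
  filter_upwards [Ioo_mem_nhdsGT hδ] with t ht
  have := h t ht.1 ht.2
  have h2 : 0 < t ^ 2 := by have := ht.1; positivity
  nlinarith

theorem exists_quadratic_taylor_approximation {V : E → ℝ} (hV : ContDiffAt ℝ 3 V 0) (h0 : V 0 = 0)
    (hnonneg : ∀ x, 0 ≤ V x) :
    ∃ (q : E → ℝ) (r M : ℝ), 0 < r ∧ 0 < M ∧
      (∀ x, iteratedDeriv 2 (fun τ : ℝ => V (τ • x)) 0 = q x) ∧
      (∀ (a : ℝ) x, q (a • x) = a ^ 2 * q x) ∧ (∀ x, 0 ≤ q x) ∧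
      (∀ x y, q y = 0 → q (x + y) = q x) ∧
      ∀ x, ‖x‖ < r → |V x - 1 / 2 * q x| ≤ M * ‖x‖ ^ 3 := by
  obtain ⟨r, M, hr, hM, hhess, hbound⟩ := exists_abs_sub_half_hessian_le hV h0
    (Eventually.of_forall fun x => h0.trans_le (hnonneg x))
  generalize fderiv ℝ (fderiv ℝ V) 0 = B at hhess hbound
  have hhom : ∀ (a : ℝ) x, B (a • x) (a • x) = a ^ 2 * B x x := fun a x => by
    simp only [map_smul, smul_apply, smul_eq_mul]
    ring
  have hBnonneg : ∀ x, 0 ≤ B x x := fun x => by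
    suffices -B x x ≤ 0 by linarith
    refine nonpos_of_forall_mul_sq_le (K := 2 * M * ‖x‖ ^ 3) (δ := r / (‖x‖ + 1))
      (by positivity) fun t ht htδ => ?_
    rw [lt_div_iff₀ (by positivity)] at htδ
    have h := hbound (t • x) (by
      rw [norm_smul, Real.norm_of_nonneg ht.le]
      linarith)
    rw [norm_smul, Real.norm_of_nonneg ht.le, mul_pow, hhom] at h
    linarith [(abs_le.1 h).2, hnonneg (t • x)]
  exact ⟨fun x => B x x, r, M, hr, hM, hhess, hhom, hBnonneg,
    fun x y hy => B.apply_add_self_of_apply_self_eq_zero hBnonneg x hy, hbound⟩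

end

theorem Matrix.transpose_mem_SO2 {R : Matrix (Fin 2) (Fin 2) ℝ} (hR : R ∈ SO2) :
    R.transpose ∈ SO2 :=
  ⟨by rw [Matrix.transpose_transpose]; exact mul_eq_one_comm.1 hR.1,
    by rw [Matrix.det_transpose]; exact hR.2⟩

theorem exists_mem_SO2_mul_sqrt_smul_one (t : ℝ) :
    ∃ R ∈ SO2, R * (√(1 + t ^ 2) • (1 : Matrix (Fin 2) (Fin 2) ℝ)) =
      1 + t • !![0, -1; 1, 0] := by
  have hpos : 0 < 1 + t ^ 2 := by positivity
  have hs : √(1 + t ^ 2) ≠ 0 := (Real.sqrt_pos.2 hpos).ne'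
  have hsq : √(1 + t ^ 2) ^ 2 = 1 + t ^ 2 := Real.sq_sqrt hpos.le
  set s := √(1 + t ^ 2)
  refine ⟨!![1 / s, -t / s; t / s, 1 / s], ⟨?_, ?_⟩, ?_⟩
  · ext i j
    fin_cases i <;> fin_cases j <;>
      simp [Matrix.mul_apply, Fin.sum_univ_two, Matrix.transpose_apply] <;> field_simp <;>
        linarith
  · rw [Matrix.det_fin_two_of]
    field_simp
    linarith
  · ext i j
    fin_cases i <;> fin_cases j <;> simp [hs, mul_div_cancel₀]

theorem sub_symPart_eq_smul (X : Matrix (Fin 2) (Fin 2) ℝ) :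
    X - 1 = (symPart X - 1) + ((X 1 0 - X 0 1) / 2) • !![0, -1; 1, 0] := by
  ext i j
  fin_cases i <;> fin_cases j <;> simp [symPart, Matrix.transpose_apply] <;> ring

theorem quadratic_approximation_rotation_generator_nonpos {W : Matrix (Fin 2) (Fin 2) ℝ → ℝ}
    (hframe : ∀ R ∈ SO2, ∀ X : Matrix (Fin 2) (Fin 2) ℝ, W (R * X) = W X)
    {q : Matrix (Fin 2) (Fin 2) ℝ → ℝ} (hq : ∀ (a : ℝ) x, q (a • x) = a ^ 2 * q x)
    {r M : ℝ} (hr : 0 < r) (hM : 0 < M)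
    (hbound : ∀ x, ‖x‖ < r → |W (1 + x) - 1 / 2 * q x| ≤ M * ‖x‖ ^ 3) :
    q !![0, -1; 1, 0] ≤ 0 := by
  obtain ⟨J, hJ⟩ : ∃ J : Matrix (Fin 2) (Fin 2) ℝ, J = !![0, -1; 1, 0] := ⟨_, rfl⟩
  obtain ⟨I, hI⟩ : ∃ I : Matrix (Fin 2) (Fin 2) ℝ, I = 1 := ⟨_, rfl⟩
  rw [← hJ]
  refine nonpos_of_forall_mul_sq_le (K := |q I| + 2 * M * ‖I‖ ^ 3 + 2 * M * ‖J‖ ^ 3)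
    (δ := min 1 (r / (‖J‖ + ‖I‖ + 1))) (by positivity) fun t ht htδ => ?_
  have ht1 : t < 1 := htδ.trans_le (min_le_left _ _)
  have htr : t * (‖J‖ + ‖I‖ + 1) < r :=
    (lt_div_iff₀ (by positivity)).1 (htδ.trans_le (min_le_right _ _))
  obtain ⟨R, hR, hRt⟩ := exists_mem_SO2_mul_sqrt_smul_one t
  have hs0 : 0 ≤ √(1 + t ^ 2) - 1 := by
    rw [sub_nonneg, Real.one_le_sqrt]; nlinarith
  have hs2 : √(1 + t ^ 2) - 1 ≤ t ^ 2 := by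
    rw [sub_le_iff_le_add, Real.sqrt_le_left (by positivity)]; nlinarith [sq_nonneg t]
  have hW : W (1 + t • J) = W (1 + (√(1 + t ^ 2) - 1) • I) := by
    rw [hJ, ← hRt, hframe R hR, hI]
    congr 1
    module
  set a := √(1 + t ^ 2) - 1
  have hat : a ≤ t := by nlinarith
  have hJr : ‖t • J‖ < r := by
    rw [norm_smul, Real.norm_of_nonneg ht.le]
    nlinarith [norm_nonneg I]
  have hIr : ‖a • I‖ < r := by
    rw [norm_smul, Real.norm_of_nonneg hs0]
    nlinarith [norm_nonneg I, norm_nonneg J, mul_nonneg ht.le (norm_nonneg J),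
      mul_le_mul_of_nonneg_right hat (norm_nonneg I)]
  have h1 := hbound _ hJr
  have h2 := hbound _ hIr
  rw [hW, norm_smul, Real.norm_of_nonneg ht.le, mul_pow, hq] at h1
  rw [norm_smul, Real.norm_of_nonneg hs0, mul_pow, hq] at h2
  have ha2 : a ^ 2 ≤ t ^ 3 := by
    calc a ^ 2 = a * a := sq a
      _ ≤ t ^ 2 * t := by gcongr
      _ = t ^ 3 := by ring
  have ha3 : a ^ 3 ≤ t ^ 3 := by gcongr
  have e1 : a ^ 2 * q I ≤ t ^ 3 * |q I| :=
    (mul_le_mul_of_nonneg_left (le_abs_self _) (sq_nonneg a)).trans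
      (mul_le_mul_of_nonneg_right ha2 (abs_nonneg _))
  have e2 : M * (a ^ 3 * ‖I‖ ^ 3) ≤ M * (t ^ 3 * ‖I‖ ^ 3) := by gcongr
  have h1' := (abs_le.1 h1).1
  have h2' := (abs_le.1 h2).2
  linarith

theorem taylor_expansion_of_energy
    (W : Matrix (Fin 2) (Fin 2) ℝ → ℝ)
    (hWnonneg : ∀ X, 0 ≤ W X)
    (hWcont : Continuous W)
    (hreg : ∃ U : Set (Matrix (Fin 2) (Fin 2) ℝ),
      IsOpen U ∧ SO2 ⊆ U ∧ ContDiffOn ℝ 3 W U)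
    (hframe : ∀ R ∈ SO2, ∀ X : Matrix (Fin 2) (Fin 2) ℝ, W (R * X) = W X)
    (hzero : ∀ X : Matrix (Fin 2) (Fin 2) ℝ, W X = 0 ↔ X ∈ SO2)
    (c : ℝ) (hc : 0 < c)
    (hlower : ∀ X : Matrix (Fin 2) (Fin 2) ℝ, c * (Metric.infDist X SO2) ^ 2 ≤ W X) :
    ∃ ε₀ C : ℝ, 0 < ε₀ ∧ 0 < C ∧
      ∀ (F R : Matrix (Fin 2) (Fin 2) ℝ), R ∈ SO2 →
        ‖R.transpose * F - 1‖ ≤ ε₀ →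
        |W F - (1 / 2) * hessQ W (symPart (R.transpose * F) - 1)| ≤
          C * ‖R.transpose * F - 1‖ ^ 3 := by
  obtain ⟨U, hU, hSU, hWU⟩ := hreg
  have hone : (1 : Matrix (Fin 2) (Fin 2) ℝ) ∈ SO2 := by simp [SO2]
  set V : Matrix (Fin 2) (Fin 2) ℝ → ℝ := fun X => W (1 + X) with hVdef
  have hV : ContDiffAt ℝ 3 V 0 := by
    have h : ContDiffAt ℝ 3 W (1 + 0) := by
      rw [add_zero]
      exact hWU.contDiffAt (hU.mem_nhds (hSU hone))
    exact h.comp 0 (contDiffAt_const.add contDiffAt_id)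
  have hV0 : V 0 = 0 := by simpa [hVdef] using (hzero 1).2 hone
  obtain ⟨q, r, M, hr, hM, hhess, hhom, hqnonneg, hadd, hbound⟩ :=
    exists_quadratic_taylor_approximation hV hV0 fun X => hWnonneg (1 + X)
  have hJ : q !![0, -1; 1, 0] = 0 :=
    (quadratic_approximation_rotation_generator_nonpos hframe hhom hr hM hbound).antisymm
      (hqnonneg _)
  refine ⟨r / 2, M, by positivity, hM, fun F R hR hFR => ?_⟩
  have hQ : hessQ W (symPart (R.transpose * F) - 1) = q (R.transpose * F - 1) := by
    rw [sub_symPart_eq_smul (R.transpose * F), hadd _ _ (by rw [hhom, hJ, mul_zero])]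
    exact hhess _
  have hWF : W F = V (R.transpose * F - 1) := by
    simp only [hVdef, add_sub_cancel]
    exact (hframe _ (Matrix.transpose_mem_SO2 hR) F).symm
  rw [hQ, hWF]
  exact hbound _ (by linarith)
end

section
/- (Bulk energy of the recovery sequence.) Let W : ℝ^{2×2} → [0,∞) be continuous, C³ in a neighborhood of SO(2), frame indifferent (W(RX) = W(X) for all R ∈ SO(2), X ∈ ℝ^{2×2}), with W(X) = 0 exactly for X ∈ SO(2) and W(X) ≥ c·dist²(X, SO(2)) for some c > 0. Let Q be the Hessian of W at the identity, Q(X) = (d²/dt²)|_{t=0} W(Id + tX), and set α = min_{γ∈ℝ²} Q(e₁⊗e₁ + γ⊗e₂). Let L > 0 and let y : ℝ → ℝ² be C^∞ with |y'(t)| = 1 for all t, and let κ(t) = y''(t)·(y'(t))^⊥. Then there exists a C^∞ map d : ℝ → ℝ² such that, defining for each h > 0 the map y^h on Ω = (0,L) × (−1/2, 1/2) by y^h(x₁,x₂) = y(x₁) + h x₂ (y'(x₁))^⊥ + (h² x₂²/2) d(x₁), one has lim_{h→0⁺} h^{−2} ∫_Ω W( ∂₁ y^h(x) | h^{−1} ∂₂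 y^h(x) ) dx = (α/24) ∫₀^L κ(t)² dt; moreover y^h converges to the map x ↦ y(x₁) uniformly on Ω as h → 0. -/
open MeasureTheory Filter Topology

/-! STATEMENT 7: Bulk energy of the recovery sequence. For a smooth unit-speed curve `y`
with curvature `κ` there is a smooth `d : ℝ → ℝ²` such that, with
`y^h(x₁,x₂) = y(x₁) + h x₂ (y')^⊥(x₁) + (h²x₂²/2) d(x₁)` on `Ω = (0,L)×(−1/2,1/2)`,
`h⁻² ∫_Ω W(∂₁y^h | h⁻¹∂₂y^h) → (α/24) ∫₀^L κ²`, and `y^h → (x ↦ y(x₁))` uniformly on `Ω`. -/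

attribute [local instance] Matrix.frobeniusNormedAddCommGroup Matrix.frobeniusNormedSpace

/-- `a^⊥ = (−a₂, a₁)ᵀ`. -/
def perp (a : Fin 2 → ℝ) : Fin 2 → ℝ := ![-(a 1), a 0]

/-- Euclidean dot product on ℝ². -/
def dot2 (a b : Fin 2 → ℝ) : ℝ := a 0 * b 0 + a 1 * b 1

/-- `(a | b)`: the 2×2 matrix with columns `a` and `b`. -/
def colsM (a b : Fin 2 → ℝ) : Matrix (Fin 2) (Fin 2) ℝ :=
  Matrix.of fun i j => if j = 0 then a i else b i

section Expansion

variable {E : Type*} [NormedAddCommGroup E] [NormedSpace ℝ E] {f : E → ℝ} {p : E}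

/-- Near a local minimum of a `C²` function, the Lipschitz constant on small balls is at most
proportional to the radius. -/
lemma exists_abs_sub_le_of_isLocalMin (hf : ContDiffAt ℝ 2 f p) (hmin : IsLocalMin f p) :
    ∃ K : ℝ, 0 ≤ K ∧ ∃ r > 0, ∀ ρ < r, ∀ u ∈ Metric.closedBall p ρ,
      ∀ v ∈ Metric.closedBall p ρ, |f u - f v| ≤ K * ρ * ‖u - v‖ := by
  have h1 : ContDiffAt ℝ 1 (fderiv ℝ f) p := hf.fderiv_right (by norm_num)
  obtain ⟨K, t, ht, hK⟩ := h1.exists_lipschitzOnWith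
  have hd : ∀ᶠ x in 𝓝 p, DifferentiableAt ℝ f x := by
    filter_upwards [hf.eventually (by simp)] with x hx using hx.differentiableAt (by norm_num)
  obtain ⟨r, hr, hball⟩ := Metric.mem_nhds_iff.1 (Filter.inter_mem ht hd)
  refine ⟨K, K.2, r, hr, fun ρ hρ u hu v hv => ?_⟩
  have hsub : ∀ x ∈ Metric.closedBall p ρ, x ∈ t ∧ DifferentiableAt ℝ f x := fun x hx =>
    hball (Metric.closedBall_subset_ball hρ hx)
  have hder : ∀ x ∈ Metric.closedBall p ρ, ‖fderiv ℝ f x‖ ≤ K * ρ := fun x hx => by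
    have h := hK.dist_le_mul x (hsub x hx).1 p (mem_of_mem_nhds ht)
    rw [hmin.fderiv_eq_zero, dist_zero_right] at h
    exact h.trans (mul_le_mul_of_nonneg_left hx K.2)
  exact (convex_closedBall p ρ).norm_image_sub_le_of_norm_fderiv_le
    (fun x hx => (hsub x hx).2) hder hv hu

lemma tendsto_div_sq_of_deriv_eq_zero {g : ℝ → ℝ} (hg : ContDiffAt ℝ 2 g 0)
    (h0 : g 0 = 0) (h1 : deriv g 0 = 0) :
    Tendsto (fun h => g h / h ^ 2) (𝓝[>] 0) (𝓝 (iteratedDeriv 2 g 0 / 2)) := by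
  have hd : ∀ᶠ x in 𝓝 (0 : ℝ), DifferentiableAt ℝ g x := by
    filter_upwards [hg.eventually (by simp)] with x hx using hx.differentiableAt (by norm_num)
  have hg' : DifferentiableAt ℝ (deriv g) 0 := by
    have : ContDiffAt ℝ 1 (fderiv ℝ g) 0 := hg.fderiv_right (by norm_num)
    exact (this.differentiableAt (by norm_num)).clm_apply (differentiableAt_const (1 : ℝ))
  have hslope := hg'.hasDerivAt.tendsto_slope_zero_right
  refine deriv.lhopital_zero_nhdsGT (hd.filter_mono nhdsWithin_le_nhds) ?_ ?_ ?_ ?_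
  · filter_upwards [self_mem_nhdsWithin] with x hx
    have : (0 : ℝ) < x := hx
    simp [this.ne']
  · have := hg.continuousAt.tendsto
    rw [h0] at this
    exact this.mono_left nhdsWithin_le_nhds
  · have : Tendsto (fun x : ℝ => x ^ 2) (𝓝 0) (𝓝 (0 ^ 2)) := (continuous_pow 2).tendsto 0
    simpa using this.mono_left nhdsWithin_le_nhds
  · have h2 : iteratedDeriv 2 g 0 = deriv (deriv g) 0 := by
      rw [iteratedDeriv_succ, iteratedDeriv_one]
    rw [h2]
    refine (hslope.div_const 2).congr fun x => ?_
    simp [h1]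
    ring

lemma tendsto_comp_add_smul_div_sq (hf : ContDiffAt ℝ 2 f p) (hmin : IsLocalMin f p)
    (h0 : f p = 0) (A B : E) :
    Tendsto (fun h : ℝ => f (p + h • A + h ^ 2 • B) / h ^ 2) (𝓝[>] 0)
      (𝓝 (iteratedDeriv 2 (fun t : ℝ => f (p + t • A)) 0 / 2)) := by
  obtain ⟨K, hK, r, hr, hb⟩ := exists_abs_sub_le_of_isLocalMin hf hmin
  have hline : Continuous fun t : ℝ => p + t • A := by fun_prop
  have hg : ContDiffAt ℝ 2 (fun t : ℝ => f (p + t • A)) 0 := by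
    refine ContDiffAt.comp (0 : ℝ) (g := f) (f := fun t : ℝ => p + t • A) (by simpa using hf) ?_
    fun_prop
  have hgmin : IsLocalMin (fun t : ℝ => f (p + t • A)) 0 := by
    have : Tendsto (fun t : ℝ => p + t • A) (𝓝 0) (𝓝 p) := by simpa using hline.tendsto 0
    filter_upwards [this.eventually hmin] with t ht
    simpa using ht
  have hmain := tendsto_div_sq_of_deriv_eq_zero hg (by simpa using h0) hgmin.deriv_eq_zero
  set C := ‖A‖ + ‖B‖
  have hsmall : Tendsto (fun h : ℝ => K * (h * C) * ‖B‖) (𝓝[>] 0) (𝓝 0) := by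
    have : Continuous fun h : ℝ => K * (h * C) * ‖B‖ := by fun_prop
    simpa using (this.tendsto 0).mono_left nhdsWithin_le_nhds
  have hrad : ∀ᶠ h : ℝ in 𝓝[>] 0, h * C < r := by
    have : Continuous fun h : ℝ => h * C := by fun_prop
    exact ((this.tendsto 0).mono_left nhdsWithin_le_nhds).eventually_lt_const (by simpa using hr)
  have hdiff : Tendsto (fun h : ℝ => f (p + h • A + h ^ 2 • B) / h ^ 2 - f (p + h • A) / h ^ 2)
      (𝓝[>] 0) (𝓝 0) := by
    refine squeeze_zero_norm' ?_ hsmall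
    filter_upwards [hrad, self_mem_nhdsWithin,
      nhdsWithin_le_nhds (Iio_mem_nhds (zero_lt_one (α := ℝ)))] with h hr' hpos hlt
    have hpos : 0 < h := hpos
    have hlt : h < 1 := hlt
    have hA : ‖h • A‖ = h * ‖A‖ := by rw [norm_smul, Real.norm_of_nonneg hpos.le]
    have hB : ‖h ^ 2 • B‖ = h ^ 2 * ‖B‖ := by rw [norm_smul, Real.norm_of_nonneg (sq_nonneg h)]
    have hle : h ^ 2 * ‖B‖ ≤ h * ‖B‖ :=
      mul_le_mul_of_nonneg_right (by nlinarith) (norm_nonneg B)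
    have key := hb (h * C) hr' (p + h • A + h ^ 2 • B)
      (by
        rw [mem_closedBall_iff_norm, add_assoc, add_sub_cancel_left]
        refine (norm_add_le _ _).trans ?_
        rw [hA, hB, mul_add]
        gcongr)
      (p + h • A)
      (by
        rw [mem_closedBall_iff_norm, add_sub_cancel_left, hA]
        have := norm_nonneg B
        gcongr
        simp [C])
    rw [add_sub_cancel_left, hB] at key
    rw [← sub_div, Real.norm_eq_abs, abs_div, abs_of_pos (pow_pos hpos 2),
      div_le_iff₀ (pow_pos hpos 2)]
    linarith
  simpa using hdiff.add hmain

/-- Second-order expansion of an integral functional around a minimum. -/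
lemma tendsto_setIntegral_comp_add_smul_div_sq (hfc : Continuous f) (hf : ContDiffAt ℝ 2 f p)
    (hmin : IsLocalMin f p) (h0 : f p = 0) {X : Type*} [TopologicalSpace X] [MeasurableSpace X]
    [OpensMeasurableSpace X] {μ : Measure X} [IsFiniteMeasureOnCompacts μ] {s k : Set X}
    (hs : MeasurableSet s) (hk : IsCompact k) (hsk : s ⊆ k)
    {A B : X → E} (hA : Continuous A) (hB : Continuous B) :
    Tendsto (fun h : ℝ => (∫ x in s, f (p + h • A x + h ^ 2 • B x) ∂μ) / h ^ 2) (𝓝[>] 0)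
      (𝓝 (∫ x in s, iteratedDeriv 2 (fun t : ℝ => f (p + t • A x)) 0 / 2 ∂μ)) := by
  obtain ⟨K, hK, r, hr, hb⟩ := exists_abs_sub_le_of_isLocalMin hf hmin
  obtain ⟨a, ha⟩ := hk.exists_bound_of_continuousOn hA.continuousOn
  obtain ⟨b, hb'⟩ := hk.exists_bound_of_continuousOn hB.continuousOn
  set C := |a| + |b|
  have hC : 0 ≤ C := by positivity
  have hrad : ∀ᶠ h : ℝ in 𝓝[>] 0, h * C < r := by
    have : Continuous fun h : ℝ => h * C := by fun_prop
    exact ((this.tendsto 0).mono_left nhdsWithin_le_nhds).eventually_lt_const (by simpa using hr)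
  have hfin : IsFiniteMeasure (μ.restrict s) :=
    ⟨by simpa using (measure_mono hsk).trans_lt hk.measure_lt_top⟩
  simp_rw [← integral_div]
  refine tendsto_integral_filter_of_dominated_convergence (fun _ => K * C * C) ?_ ?_
    (integrable_const _) ?_
  · refine Eventually.of_forall fun h => Continuous.aestronglyMeasurable ?_
    fun_prop
  · filter_upwards [hrad, self_mem_nhdsWithin,
      nhdsWithin_le_nhds (Iio_mem_nhds (zero_lt_one (α := ℝ)))] with h hr' hpos hlt
    have hpos : 0 < h := hpos
    have hlt : h < 1 := hlt
    refine (ae_restrict_iff' hs).2 (Eventually.of_forall fun x hx => ?_)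
    have hz : ‖h • A x + h ^ 2 • B x‖ ≤ h * C := by
      refine (norm_add_le _ _).trans ?_
      rw [norm_smul, norm_smul, Real.norm_of_nonneg hpos.le, Real.norm_of_nonneg (sq_nonneg h),
        mul_add]
      have h1 := (ha x (hsk hx)).trans (le_abs_self a)
      have h2 := (hb' x (hsk hx)).trans (le_abs_self b)
      have h3 : h ^ 2 ≤ h := by nlinarith
      gcongr
    have key := hb (h * C) hr' (p + h • A x + h ^ 2 • B x)
      (by rwa [mem_closedBall_iff_norm, add_assoc, add_sub_cancel_left])
      p (Metric.mem_closedBall_self (by positivity))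
    rw [h0, sub_zero, add_assoc, add_sub_cancel_left] at key
    rw [Real.norm_eq_abs, abs_div, abs_of_pos (pow_pos hpos 2), div_le_iff₀ (pow_pos hpos 2),
      add_assoc]
    calc _ ≤ K * (h * C) * (h * C) := key.trans (by gcongr)
      _ = _ := by ring
  · exact Eventually.of_forall fun x => tendsto_comp_add_smul_div_sq hf hmin h0 _ _

lemma iteratedDeriv_two_comp_mul (g : ℝ → ℝ) (s : ℝ) :
    iteratedDeriv 2 (fun t => g (s * t)) 0 = s ^ 2 * iteratedDeriv 2 g 0 := by
  have h1 : deriv (fun t => g (s * t)) = fun t => s * deriv g (s * t) := by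
    funext t
    simpa using deriv_comp_mul_left s g t
  have h2 := deriv_comp_mul_left s (deriv g) 0
  rw [mul_zero, smul_eq_mul] at h2
  rw [iteratedDeriv_succ, iteratedDeriv_one, iteratedDeriv_succ, iteratedDeriv_one, h1,
    deriv_const_mul_field, h2]
  ring

lemma tendstoUniformlyOn_add_smul {X : Type*} [TopologicalSpace X] {s k : Set X}
    (hk : IsCompact k) (hsk : s ⊆ k) (u : X → E) {A B : X → E} (hA : Continuous A)
    (hB : Continuous B) :
    TendstoUniformlyOn (fun (h : ℝ) x => u x + h • A x + h ^ 2 • B x) u (𝓝[>] 0) s := by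
  obtain ⟨a, ha⟩ := hk.exists_bound_of_continuousOn hA.continuousOn
  obtain ⟨b, hb⟩ := hk.exists_bound_of_continuousOn hB.continuousOn
  rw [Metric.tendstoUniformlyOn_iff]
  intro ε hε
  have hcont : Continuous fun h : ℝ => h * a + h ^ 2 * b := by fun_prop
  have hlim : ∀ᶠ h : ℝ in 𝓝[>] 0, h * a + h ^ 2 * b < ε :=
    ((hcont.tendsto 0).mono_left nhdsWithin_le_nhds).eventually_lt_const (by simpa using hε)
  filter_upwards [hlim, self_mem_nhdsWithin] with h hh hpos x hx
  have hpos : 0 < h := hpos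
  rw [dist_comm, dist_eq_norm, add_assoc, add_sub_cancel_left]
  refine lt_of_le_of_lt (norm_add_le _ _) (lt_of_le_of_lt ?_ hh)
  rw [norm_smul, norm_smul, Real.norm_of_nonneg hpos.le, Real.norm_of_nonneg (sq_nonneg h)]
  have h1 := ha x (hsk hx)
  have h2 := hb x (hsk hx)
  gcongr

end Expansion

section Frame

lemma hasDerivAt_perp {f : ℝ → Fin 2 → ℝ} {f' : Fin 2 → ℝ} {t : ℝ} (hf : HasDerivAt f f' t) :
    HasDerivAt (fun s => perp (f s)) (perp f') t := by
  rw [hasDerivAt_pi] at hf ⊢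
  intro i
  fin_cases i
  · simpa [perp] using (hf 1).fun_neg
  · simpa [perp] using hf 0

lemma contDiff_perp {f : ℝ → Fin 2 → ℝ} {n : WithTop ℕ∞} (hf : ContDiff ℝ n f) :
    ContDiff ℝ n (fun s => perp (f s)) := by
  rw [contDiff_pi] at hf ⊢
  intro i
  fin_cases i
  · simpa [perp] using (hf 1).neg
  · simpa [perp] using hf 0

lemma contDiff_dot2 {f g : ℝ → Fin 2 → ℝ} {n : WithTop ℕ∞} (hf : ContDiff ℝ n f)
    (hg : ContDiff ℝ n g) : ContDiff ℝ n (fun s => dot2 (f s) (g s)) := by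
  rw [contDiff_pi] at hf hg
  exact ((hf 0).mul (hg 0)).add ((hf 1).mul (hg 1))

lemma colsM_perp_mem_SO2 {τ : Fin 2 → ℝ} (hτ : τ 0 ^ 2 + τ 1 ^ 2 = 1) :
    colsM τ (perp τ) ∈ SO2 := by
  constructor
  · ext i j
    fin_cases i <;> fin_cases j <;>
      simp [colsM, perp, Matrix.mul_apply, Fin.sum_univ_two] <;> linarith
  · simp [colsM, perp, Matrix.det_fin_two]
    linarith

lemma deriv_eq_dot2_smul_perp {τ : ℝ → Fin 2 → ℝ} {t : ℝ} (hτ : DifferentiableAt ℝ τ t)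
    (hunit : ∀ s, τ s 0 ^ 2 + τ s 1 ^ 2 = 1) :
    deriv τ t = dot2 (deriv τ t) (perp (τ t)) • perp (τ t) := by
  have h := hasDerivAt_pi.1 hτ.hasDerivAt
  have h1 := ((h 0).fun_pow 2).fun_add ((h 1).fun_pow 2)
  simp_rw [hunit] at h1
  have h2 := h1.unique (hasDerivAt_const t (1 : ℝ))
  have h3 := hunit t
  norm_num at h2
  ext i
  fin_cases i
  · simp [dot2, perp]
    linear_combination (-deriv τ t 0) * h3 + (τ t 0 / 2) * h2
  · simp [dot2, perp]
    linear_combination (-deriv τ t 1) * h3 + (τ t 1 / 2) * h2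

/-- The rescaled gradient in the moving frame of the curve. -/
lemma colsM_eq_frame_mul {τ τ' γ δ : Fin 2 → ℝ} {k : ℝ} (h s : ℝ)
    (hτ : τ 0 ^ 2 + τ 1 ^ 2 = 1) (hk : τ' = k • perp τ) :
    colsM (τ + (h * s) • perp τ' + (h ^ 2 * s ^ 2 / 2) • δ)
      (perp τ + (h * s) • (-k) • (γ 0 • τ + γ 1 • perp τ)) =
    colsM τ (perp τ) *
      (1 + h • (-(s * k)) • (Matrix.vecMulVec e1 e1 + Matrix.vecMulVec γ e2) +
        h ^ 2 • (s ^ 2 / 2) • ((colsM τ (perp τ)).transpose * colsM δ 0)) := by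
  subst hk
  ext i j
  fin_cases i <;> fin_cases j <;>
    simp [colsM, perp, e1, e2, Matrix.mul_apply, Fin.sum_univ_two, Matrix.vecHead,
      Matrix.vecTail]
  · linear_combination (-(h ^ 2 * s ^ 2 / 2) * δ 0) * hτ
  · ring
  · linear_combination (-(h ^ 2 * s ^ 2 / 2) * δ 1) * hτ
  · ring

lemma hessQ_smul (W : Matrix (Fin 2) (Fin 2) ℝ → ℝ) (s : ℝ) (X : Matrix (Fin 2) (Fin 2) ℝ) :
    hessQ W (s • X) = s ^ 2 * hessQ W X := by
  rw [hessQ, hessQ, ← iteratedDeriv_two_comp_mul]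
  simp only [smul_smul, mul_comm]

lemma continuous_colsM {X : Type*} [TopologicalSpace X] {f g : X → Fin 2 → ℝ}
    (hf : Continuous f) (hg : Continuous g) : Continuous (fun x => colsM (f x) (g x)) := by
  refine continuous_matrix fun i j => ?_
  fin_cases j
  · simpa [colsM] using continuous_pi_iff.1 hf i
  · simpa [colsM] using continuous_pi_iff.1 hg i

end Frame

theorem recovery_sequence_bulk_energy
    (W : Matrix (Fin 2) (Fin 2) ℝ → ℝ)
    (hWnonneg : ∀ X, 0 ≤ W X)
    (hWcont : Continuous W)
    (hreg : ∃ U : Set (Matrix (Fin 2) (Fin 2) ℝ),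
      IsOpen U ∧ SO2 ⊆ U ∧ ContDiffOn ℝ 3 W U)
    (hframe : ∀ R ∈ SO2, ∀ X : Matrix (Fin 2) (Fin 2) ℝ, W (R * X) = W X)
    (hzero : ∀ X : Matrix (Fin 2) (Fin 2) ℝ, W X = 0 ↔ X ∈ SO2)
    (c : ℝ) (hc : 0 < c)
    (hlower : ∀ X : Matrix (Fin 2) (Fin 2) ℝ, c * (Metric.infDist X SO2) ^ 2 ≤ W X)
    (α : ℝ)
    (hα : IsLeast {v : ℝ | ∃ γ : Fin 2 → ℝ,
      v = hessQ W (Matrix.vecMulVec e1 e1 + Matrix.vecMulVec γ e2)} α)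
    (L : ℝ) (hL : 0 < L)
    (y : ℝ → Fin 2 → ℝ) (hy : ContDiff ℝ (⊤ : ℕ∞) y)
    (hunit : ∀ t : ℝ, (deriv y t 0) ^ 2 + (deriv y t 1) ^ 2 = 1) :
    ∃ d : ℝ → Fin 2 → ℝ, ContDiff ℝ (⊤ : ℕ∞) d ∧
      Tendsto
        (fun h : ℝ =>
          (∫ x in (Set.Ioo (0 : ℝ) L) ×ˢ (Set.Ioo (-(1 / 2) : ℝ) (1 / 2)),
            W (colsM
              (deriv (fun s : ℝ =>
                y s + (h * x.2) • perp (deriv y s) + (h ^ 2 * x.2 ^ 2 / 2) • d s) x.1)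
              (h⁻¹ • deriv (fun s : ℝ =>
                y x.1 + (h * s) • perp (deriv y x.1) + (h ^ 2 * s ^ 2 / 2) • d x.1) x.2)))
            / h ^ 2)
        (nhdsWithin 0 (Set.Ioi 0))
        (𝓝 ((α / 24) * ∫ t in Set.Ioo (0 : ℝ) L,
          (dot2 (deriv (deriv y) t) (perp (deriv y t))) ^ 2)) ∧
      TendstoUniformlyOn
        (fun (h : ℝ) (x : ℝ × ℝ) =>
          y x.1 + (h * x.2) • perp (deriv y x.1) + (h ^ 2 * x.2 ^ 2 / 2) • d x.1)
        (fun x => y x.1)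
        (nhdsWithin 0 (Set.Ioi 0))
        ((Set.Ioo (0 : ℝ) L) ×ˢ (Set.Ioo (-(1 / 2) : ℝ) (1 / 2))) := by
  obtain ⟨γ, hγ⟩ := hα.1
  obtain ⟨U, hU, hSU, hWU⟩ := hreg
  have hone : (1 : Matrix (Fin 2) (Fin 2) ℝ) ∈ SO2 := by simp [SO2]
  have hW1 : ContDiffAt ℝ 2 W 1 :=
    (hWU.contDiffAt (hU.mem_nhds (hSU hone))).of_le (by norm_num)
  have hWone : W 1 = 0 := (hzero 1).2 hone
  have hmin : IsLocalMin W 1 := Eventually.of_forall fun X => hWone ▸ hWnonneg X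
  have hτ : ContDiff ℝ (⊤ : ℕ∞) (deriv y) := (contDiff_infty_iff_deriv.1 hy).2
  have hτ' : ContDiff ℝ (⊤ : ℕ∞) (deriv (deriv y)) := (contDiff_infty_iff_deriv.1 hτ).2
  have hτd : Differentiable ℝ (deriv y) := (contDiff_infty_iff_deriv.1 hτ).1
  have hyd : Differentiable ℝ y := (contDiff_infty_iff_deriv.1 hy).1
  set k : ℝ → ℝ := fun t => dot2 (deriv (deriv y) t) (perp (deriv y t))
  have hk : ContDiff ℝ (⊤ : ℕ∞) k := contDiff_dot2 hτ' (contDiff_perp hτ)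
  set d : ℝ → Fin 2 → ℝ :=
    fun t => (-k t) • (γ 0 • deriv y t + γ 1 • perp (deriv y t)) with hd_def
  have hd : ContDiff ℝ (⊤ : ℕ∞) d :=
    hk.neg.smul ((hτ.const_smul (γ 0)).add ((contDiff_perp hτ).const_smul (γ 1)))
  have hd' : Continuous (deriv d) := (contDiff_infty_iff_deriv.1 hd).2.continuous
  have hdd : Differentiable ℝ d := (contDiff_infty_iff_deriv.1 hd).1
  have hcτ := hτ.continuous
  have hcN := (contDiff_perp hτ).continuous
  have hck := hk.continuous
  have hcd := hd.continuous
  have hcompact : IsCompact (Set.Icc (0 : ℝ) L ×ˢ Set.Icc (-(1 / 2) : ℝ) (1 / 2)) :=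
    isCompact_Icc.prod isCompact_Icc
  have hsub : Set.Ioo (0 : ℝ) L ×ˢ Set.Ioo (-(1 / 2) : ℝ) (1 / 2) ⊆
      Set.Icc (0 : ℝ) L ×ˢ Set.Icc (-(1 / 2) : ℝ) (1 / 2) :=
    Set.prod_mono Set.Ioo_subset_Icc_self Set.Ioo_subset_Icc_self
  refine ⟨d, hd, ?_, ?_⟩
  · set A₀ := Matrix.vecMulVec e1 e1 + Matrix.vecMulVec γ e2
    have hA : Continuous fun x : ℝ × ℝ => (-(x.2 * k x.1)) • A₀ := by fun_prop
    have hB : Continuous fun x : ℝ × ℝ => (x.2 ^ 2 / 2) •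
        ((colsM (deriv y x.1) (perp (deriv y x.1))).transpose * colsM (deriv d x.1) 0) := by
      have h1 : Continuous fun x : ℝ × ℝ => colsM (deriv y x.1) (perp (deriv y x.1)) :=
        continuous_colsM (hcτ.comp continuous_fst) (hcN.comp continuous_fst)
      have h2 : Continuous fun x : ℝ × ℝ => colsM (deriv d x.1) 0 :=
        continuous_colsM (hd'.comp continuous_fst) continuous_const
      exact (by fun_prop : Continuous fun x : ℝ × ℝ => x.2 ^ 2 / 2).smul
        (h1.matrix_transpose.matrix_mul h2)
    have key := tendsto_setIntegral_comp_add_smul_div_sq (μ := (volume : Measure (ℝ × ℝ)))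
      hWcont hW1 hmin hWone
      (measurableSet_Ioo.prod measurableSet_Ioo) hcompact hsub hA hB
    have hval : ∫ x in Set.Ioo (0 : ℝ) L ×ˢ Set.Ioo (-(1 / 2) : ℝ) (1 / 2),
        iteratedDeriv 2 (fun t : ℝ => W (1 + t • (-(x.2 * k x.1)) • A₀)) 0 / 2 =
        (α / 24) * ∫ t in Set.Ioo (0 : ℝ) L, k t ^ 2 := by
      have h1 : ∀ x : ℝ × ℝ,
          iteratedDeriv 2 (fun t : ℝ => W (1 + t • (-(x.2 * k x.1)) • A₀)) 0 / 2 =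
          k x.1 ^ 2 * (α / 2 * x.2 ^ 2) := fun x => by
        have := hessQ_smul W (-(x.2 * k x.1)) A₀
        rw [hessQ, ← hγ] at this
        rw [this]
        ring
      have h2 : ∫ s in Set.Ioo (-(1 / 2) : ℝ) (1 / 2), s ^ 2 = 1 / 12 := by
        rw [← integral_Ioc_eq_integral_Ioo, ← intervalIntegral.integral_of_le (by norm_num),
          integral_pow]
        norm_num
      simp_rw [h1]
      rw [Measure.volume_eq_prod,
        setIntegral_prod_mul (fun t => k t ^ 2) (fun s => α / 2 * s ^ 2),
        integral_const_mul, h2]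
      ring
    rw [hval] at key
    refine key.congr' ?_
    filter_upwards [self_mem_nhdsWithin] with h hpos
    have hpos : h ≠ 0 := ne_of_gt hpos
    congr 2
    funext x
    have hx1 : deriv (fun s : ℝ =>
        y s + (h * x.2) • perp (deriv y s) + (h ^ 2 * x.2 ^ 2 / 2) • d s) x.1 =
        deriv y x.1 + (h * x.2) • perp (deriv (deriv y) x.1) +
          (h ^ 2 * x.2 ^ 2 / 2) • deriv d x.1 :=
      (((hyd x.1).hasDerivAt.fun_add
        ((hasDerivAt_perp (hτd x.1).hasDerivAt).fun_const_smul (h * x.2))).fun_add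
        ((hdd x.1).hasDerivAt.fun_const_smul (h ^ 2 * x.2 ^ 2 / 2))).deriv
    have hx2 : h⁻¹ • deriv (fun s : ℝ =>
        y x.1 + (h * s) • perp (deriv y x.1) + (h ^ 2 * s ^ 2 / 2) • d x.1) x.2 =
        perp (deriv y x.1) + (h * x.2) • d x.1 := by
      have hd1 : HasDerivAt (fun s : ℝ => h * s) h x.2 := by
        simpa using (hasDerivAt_id x.2).const_mul h
      have hd2 : HasDerivAt (fun s : ℝ => h ^ 2 * s ^ 2 / 2) (h ^ 2 * x.2) x.2 := by
        refine (((hasDerivAt_pow 2 x.2).const_mul (h ^ 2)).div_const 2).congr_deriv ?_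
        norm_num
        ring
      have hd3 := ((hd1.smul_const (perp (deriv y x.1))).const_add (y x.1)).fun_add
        (hd2.smul_const (d x.1))
      rw [hd3.deriv, smul_add, smul_smul, smul_smul, inv_mul_cancel₀ hpos, one_smul]
      congr 2
      field_simp
    rw [hx1, hx2, hd_def]
    have hcol := colsM_eq_frame_mul (γ := γ) (δ := deriv d x.1) h x.2 (hunit x.1)
      (deriv_eq_dot2_smul_perp (hτd x.1) hunit)
    rw [hcol, hframe _ (colsM_perp_mem_SO2 (hunit x.1))]
  · have hA : Continuous fun x : ℝ × ℝ => x.2 • perp (deriv y x.1) :=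
      continuous_snd.smul (hcN.comp continuous_fst)
    have hB : Continuous fun x : ℝ × ℝ => (x.2 ^ 2 / 2) • d x.1 :=
      ((continuous_snd.pow 2).div_const 2).smul (hcd.comp continuous_fst)
    have key := tendstoUniformlyOn_add_smul hcompact hsub (fun x => y x.1) hA hB
    simp only [smul_smul, ← mul_div_assoc] at key
    exact key
end

section
/- (Smooth approximation of unit-speed W^{2,2} curves.) Let 0 < L < M and let y : [0,L] → ℝ² be continuously differentiable with y' absolutely continuous, derivative y'' ∈ L²((0,L);ℝ²), |y'(t)| = 1 for all t ∈ [0,L], and sup_{t∈[0,L]} |y(t)| < M. Then there exists a sequence y_k ∈ C^∞([0,L];ℝ²) with |y_k'(t)| = 1 for all t and sup_{t∈[0,L]} |y_k(t)| < M for every k, such that y_k → y and y_k' → y' uniformly on [0,L] and ∫₀^L |y_k'' − y''|² → 0. In particular the curvatures κ_k = y_k''·(y_k')^⊥ converge to κ = y''·(y')^⊥ in L²((0,L)). -/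
open MeasureTheory Filter Topology

theorem LipschitzWith.comp_absolutelyContinuousOnInterval {K : NNReal} {φ f : ℝ → ℝ} {a b : ℝ}
    (hφ : LipschitzWith K φ) (hf : AbsolutelyContinuousOnInterval f a b) :
    AbsolutelyContinuousOnInterval (fun t => φ (f t)) a b := by
  unfold AbsolutelyContinuousOnInterval at hf ⊢
  refine squeeze_zero (fun _ => Finset.sum_nonneg fun _ _ => dist_nonneg) (fun E => ?_)
    (by simpa using hf.const_mul (K : ℝ))
  rw [Finset.mul_sum]
  exact Finset.sum_le_sum fun i _ => hφ.dist_le_mul _ _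

theorem absolutelyContinuousOnInterval_const_add_integral {f : ℝ → ℝ} {L : ℝ} (c : ℝ)
    (hf : IntervalIntegrable f volume 0 L) :
    AbsolutelyContinuousOnInterval (fun t => c + ∫ τ in (0 : ℝ)..t, f τ) 0 L :=
  ((LipschitzWith.const c).add LipschitzWith.id).comp_absolutelyContinuousOnInterval
    (hf.absolutelyContinuousOnInterval_intervalIntegral Set.left_mem_uIcc)

theorem ae_hasDerivAt_const_add_integral {f : ℝ → ℝ} {L : ℝ} (c : ℝ)
    (hf : IntervalIntegrable f volume 0 L) :
    ∀ᵐ t, t ∈ Set.uIcc 0 L → HasDerivAt (fun t => c + ∫ τ in (0 : ℝ)..t, f τ) (f t) t := by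
  filter_upwards [hf.ae_hasDerivAt_integral] with t ht htm
  exact (ht htm 0 Set.left_mem_uIcc).const_add c

/-- A planar curve on the unit circle whose components are primitives of `a` and `b` has
velocity orthogonal to its position almost everywhere. -/
theorem ae_tangential_of_unit_circle {L p₀ q₀ : ℝ} {a b p q : ℝ → ℝ} (hL : 0 < L)
    (ha : IntervalIntegrable a volume 0 L) (hb : IntervalIntegrable b volume 0 L)
    (hp : p = fun t => p₀ + ∫ τ in (0 : ℝ)..t, a τ)
    (hq : q = fun t => q₀ + ∫ τ in (0 : ℝ)..t, b τ)
    (hunit : ∀ t ∈ Set.Icc 0 L, p t ^ 2 + q t ^ 2 = 1) :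
    ∀ᵐ t, t ∈ Set.Ioo 0 L →
      a t = -((b t * p t - a t * q t) * q t) ∧ b t = (b t * p t - a t * q t) * p t := by
  filter_upwards [ae_hasDerivAt_const_add_integral p₀ ha, ae_hasDerivAt_const_add_integral q₀ hb]
    with t hpt hqt ht
  have htu : t ∈ Set.uIcc 0 L := by
    rw [Set.uIcc_of_le hL.le]; exact Set.Ioo_subset_Icc_self ht
  have hpd : HasDerivAt p (a t) t := hp ▸ hpt htu
  have hqd : HasDerivAt q (b t) t := hq ▸ hqt htu
  have h1 := (hpd.pow 2).add (hqd.pow 2)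
  have h2 : HasDerivAt (fun t => p t ^ 2 + q t ^ 2) 0 t :=
    (hasDerivAt_const t (1 : ℝ)).congr_of_eventuallyEq <| by
      filter_upwards [Ioo_mem_nhds ht.1 ht.2] with s hs
      exact hunit s (Set.Ioo_subset_Icc_self hs)
  have h3 := h1.unique h2
  have h4 := hunit t (Set.Ioo_subset_Icc_self ht)
  simp only [Nat.cast_ofNat, Nat.add_one_sub_one, pow_one] at h3
  constructor
  · linear_combination (-a t) * h4 + (p t / 2) * h3
  · linear_combination (-b t) * h4 + (q t / 2) * h3

/-- Lifting of an absolutely continuous curve on the unit circle to an angle function. -/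
theorem exists_angle_of_unit_circle {L p₀ q₀ : ℝ} {a b p q κ : ℝ → ℝ} (hL : 0 < L)
    (ha : IntervalIntegrable a volume 0 L) (hb : IntervalIntegrable b volume 0 L)
    (hκ : IntervalIntegrable κ volume 0 L)
    (hp : p = fun t => p₀ + ∫ τ in (0 : ℝ)..t, a τ)
    (hq : q = fun t => q₀ + ∫ τ in (0 : ℝ)..t, b τ)
    (hunit : ∀ t ∈ Set.Icc 0 L, p t ^ 2 + q t ^ 2 = 1)
    (haκ : ∀ᵐ t, t ∈ Set.Ioo 0 L → a t = -(κ t * q t) ∧ b t = κ t * p t) :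
    ∃ θ₀ : ℝ, ∀ t ∈ Set.Icc 0 L, p t = Real.cos (θ₀ + ∫ τ in (0 : ℝ)..t, κ τ) ∧
      q t = Real.sin (θ₀ + ∫ τ in (0 : ℝ)..t, κ τ) := by
  set θ : ℝ → ℝ := fun t => 0 + ∫ τ in (0 : ℝ)..t, κ τ with hθ
  have hθac : AbsolutelyContinuousOnInterval θ 0 L :=
    absolutelyContinuousOnInterval_const_add_integral 0 hκ
  have hpac : AbsolutelyContinuousOnInterval p 0 L :=
    hp ▸ absolutelyContinuousOnInterval_const_add_integral p₀ ha
  have hqac : AbsolutelyContinuousOnInterval q 0 L :=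
    hq ▸ absolutelyContinuousOnInterval_const_add_integral q₀ hb
  have hcac := Real.lipschitzWith_cos.comp_absolutelyContinuousOnInterval hθac
  have hsac := Real.lipschitzWith_sin.comp_absolutelyContinuousOnInterval hθac
  have hae : ∀ᵐ t, t ∈ Set.uIcc 0 L → t ∈ Set.Ioo 0 L := by
    have h0 : ∀ᵐ t : ℝ, t ≠ 0 := by simp [ae_iff, measure_singleton]
    have h1 : ∀ᵐ t : ℝ, t ≠ L := by simp [ae_iff, measure_singleton]
    filter_upwards [h0, h1] with t h0 h1 ht
    rw [Set.uIcc_of_le hL.le] at ht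
    exact ⟨lt_of_le_of_ne ht.1 h0.symm, lt_of_le_of_ne ht.2 h1⟩
  have hder : ∀ᵐ t, t ∈ Set.uIcc 0 L →
      HasDerivAt p (-(κ t * q t)) t ∧ HasDerivAt q (κ t * p t) t ∧ HasDerivAt θ (κ t) t := by
    filter_upwards [ae_hasDerivAt_const_add_integral p₀ ha,
      ae_hasDerivAt_const_add_integral q₀ hb, ae_hasDerivAt_const_add_integral 0 hκ, haκ, hae]
      with t hpt hqt hθt hab htI ht
    obtain ⟨h1, h2⟩ := hab (htI ht)
    rw [← h1, ← h2]
    exact ⟨hp ▸ hpt ht, hq ▸ hqt ht, hθt ht⟩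
  obtain ⟨c, hc⟩ := ((hpac.fun_mul hcac).fun_add
    (hqac.fun_mul hsac)).const_of_ae_hasDerivAt_zero (by
      filter_upwards [hder] with t h ht
      obtain ⟨h1, h2, h3⟩ := h ht
      convert! (h1.mul h3.cos).add (h2.mul h3.sin) using 1
      ring)
  obtain ⟨s, hs⟩ := ((hqac.fun_mul hcac).fun_sub
    (hpac.fun_mul hsac)).const_of_ae_hasDerivAt_zero (by
      filter_upwards [hder] with t h ht
      obtain ⟨h1, h2, h3⟩ := h ht
      convert! (h2.mul h3.cos).sub (h1.mul h3.sin) using 1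
      ring)
  rw [Set.uIcc_of_le hL.le] at hc hs
  have hcs : c ^ 2 + s ^ 2 = 1 := by
    have h0 : (0 : ℝ) ∈ Set.Icc 0 L := ⟨le_rfl, hL.le⟩
    rw [← hc 0 h0, ← hs 0 h0, ← hunit 0 h0]
    linear_combination (p 0 ^ 2 + q 0 ^ 2) * Real.cos_sq_add_sin_sq (θ 0)
  have hz : ‖(⟨c, s⟩ : ℂ)‖ = 1 := by
    rw [Complex.norm_def, Complex.normSq_mk, ← sq, ← sq, hcs, Real.sqrt_one]
  obtain ⟨θ₀, hc0, hs0⟩ : ∃ θ₀, c = Real.cos θ₀ ∧ s = Real.sin θ₀ := by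
    obtain ⟨θ₀, h⟩ := (Complex.norm_eq_one_iff _).1 hz
    have hre := congrArg Complex.re h
    have him := congrArg Complex.im h
    rw [Complex.exp_ofReal_mul_I_re] at hre
    rw [Complex.exp_ofReal_mul_I_im] at him
    exact ⟨θ₀, hre.symm, him.symm⟩
  refine ⟨θ₀, fun t ht => ?_⟩
  have e : θ₀ + ∫ τ in (0 : ℝ)..t, κ τ = θ₀ + θ t := by simp [hθ]
  rw [e, Real.cos_add θ₀, Real.sin_add θ₀, ← hc0, ← hs0, ← hc t ht, ← hs t ht]
  constructor
  · linear_combination (-p t) * Real.cos_sq_add_sin_sq (θ t)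
  · linear_combination (-q t) * Real.cos_sq_add_sin_sq (θ t)

theorem contDiff_const_add_integral {f : ℝ → ℝ} (c : ℝ) (hf : ContDiff ℝ (⊤ : ℕ∞) f) :
    ContDiff ℝ (⊤ : ℕ∞) (fun t => c + ∫ τ in (0 : ℝ)..t, f τ) := by
  have h : ∀ t, HasDerivAt (fun t => c + ∫ τ in (0 : ℝ)..t, f τ) (f t) t := fun t =>
    ((hf.continuous.integral_hasStrictDerivAt 0 t).hasDerivAt).const_add c
  refine contDiff_infty_iff_deriv.2 ⟨fun t => (h t).differentiableAt, ?_⟩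
  rwa [show deriv (fun t => c + ∫ τ in (0 : ℝ)..t, f τ) = f from funext fun t => (h t).deriv]

theorem exists_contDiff_setIntegral_sq_sub_le {L : ℝ} {κ : ℝ → ℝ}
    (hκ : MemLp κ 2 (volume.restrict (Set.Ioo 0 L))) {ε : ℝ} (hε : 0 < ε) :
    ∃ k : ℝ → ℝ, ContDiff ℝ (⊤ : ℕ∞) k ∧
      MemLp (fun t => k t - κ t) 2 (volume.restrict (Set.Ioo 0 L)) ∧
      ∫ t in Set.Ioo 0 L, (k t - κ t) ^ 2 ≤ ε ^ 2 := by
  obtain ⟨k, hks, hk, hle⟩ := hκ.exist_eLpNorm_sub_le (by simp) (by norm_num) hε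
  have hm : MemLp (fun t => k t - κ t) 2 (volume.restrict (Set.Ioo 0 L)) :=
    (hk.continuous.memLp_of_hasCompactSupport hks).sub hκ
  refine ⟨k, hk, hm, ?_⟩
  rw [eLpNorm_sub_comm] at hle
  have h1 := hm.eLpNorm_eq_integral_rpow_norm (by simp) (by simp)
  change eLpNorm (fun t => k t - κ t) 2 _ ≤ _ at hle
  rw [h1, ENNReal.ofReal_le_ofReal_iff hε.le] at hle
  simp only [ENNReal.toReal_ofNat, Real.rpow_ofNat, Real.norm_eq_abs, sq_abs] at hle
  have h0 : 0 ≤ ∫ t in Set.Ioo 0 L, (k t - κ t) ^ 2 := integral_nonneg fun t => sq_nonneg _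
  calc ∫ t in Set.Ioo 0 L, (k t - κ t) ^ 2
      = ((∫ t in Set.Ioo 0 L, (k t - κ t) ^ 2) ^ (2 : ℝ)⁻¹) ^ 2 := by
        rw [← Real.rpow_natCast, ← Real.rpow_mul h0]; norm_num
    _ ≤ ε ^ 2 := by gcongr

/-- An elementary form of the Cauchy–Schwarz inequality for primitives. -/
theorem abs_integral_le_of_setIntegral_sq_le {L ε : ℝ} {f : ℝ → ℝ} (hL : 0 < L) (hε : 0 < ε)
    (hf : MemLp f 2 (volume.restrict (Set.Ioo 0 L)))
    (hle : ∫ t in Set.Ioo 0 L, f t ^ 2 ≤ ε ^ 2) {t : ℝ} (ht : t ∈ Set.Icc 0 L) :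
    |∫ τ in (0 : ℝ)..t, f τ| ≤ (L + 1) * ε := by
  have hint : IntegrableOn (fun τ => ε + f τ ^ 2 / ε) (Set.Ioo 0 L) :=
    (integrable_const ε).add (hf.integrable_sq.div_const ε)
  have hpt : ∀ x : ℝ, |x| ≤ ε + x ^ 2 / ε := fun x => by
    rw [← sub_le_iff_le_add', le_div_iff₀ hε]
    nlinarith [sq_nonneg (|x| - ε), sq_abs x, abs_nonneg x]
  rw [intervalIntegral.integral_of_le ht.1, integral_Ioc_eq_integral_Ioo]
  calc |∫ τ in Set.Ioo 0 t, f τ| ≤ ∫ τ in Set.Ioo 0 t, |f τ| := abs_integral_le_integral_abs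
    _ ≤ ∫ τ in Set.Ioo 0 t, (ε + f τ ^ 2 / ε) :=
        integral_mono_of_nonneg (.of_forall fun _ => abs_nonneg _)
          (hint.mono_set (Set.Ioo_subset_Ioo_right ht.2)) (.of_forall fun _ => hpt _)
    _ ≤ ∫ τ in Set.Ioo 0 L, (ε + f τ ^ 2 / ε) :=
        setIntegral_mono_set hint (.of_forall fun _ => (abs_nonneg _).trans (hpt _))
          (Set.Ioo_subset_Ioo_right ht.2).eventuallyLE
    _ = L * ε + (∫ τ in Set.Ioo 0 L, f τ ^ 2) / ε := by
        rw [integral_add (integrable_const ε) (hf.integrable_sq.div_const ε), integral_div]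
        simp [hL.le]
    _ ≤ L * ε + ε ^ 2 / ε := by gcongr
    _ = (L + 1) * ε := by field_simp

/-- The smooth unit-speed curve with prescribed initial point and tangent angle. -/
theorem exists_contDiff_deriv_eq_cos_sin {φ : ℝ → ℝ} (hφ : ContDiff ℝ (⊤ : ℕ∞) φ)
    (c : EuclideanSpace ℝ (Fin 2)) :
    ∃ Y : ℝ → EuclideanSpace ℝ (Fin 2), ContDiff ℝ (⊤ : ℕ∞) Y ∧ Y 0 = c ∧
      (∀ t, HasDerivAt Y !₂[Real.cos (φ t), Real.sin (φ t)] t) ∧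
      ∀ t, deriv (deriv Y) t =
        !₂[-(deriv φ t * Real.sin (φ t)), deriv φ t * Real.cos (φ t)] := by
  have hvec : ∀ {u v : ℝ → ℝ} {u' v' t : ℝ}, HasDerivAt u u' t → HasDerivAt v v' t →
      HasDerivAt (fun t => (!₂[u t, v t] : EuclideanSpace ℝ (Fin 2))) !₂[u', v'] t := by
    intro u v u' v' t hu hv
    refine ((PiLp.continuousLinearEquiv 2 ℝ (fun _ : Fin 2 => ℝ)).symm.hasFDerivAt.comp_hasDerivAt
      t (hasDerivAt_pi (φ := fun t => ![u t, v t]) (φ' := ![u', v']).2 fun i => ?_))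
    fin_cases i <;> assumption
  have hint : ∀ {f : ℝ → ℝ} (c : ℝ), ContDiff ℝ (⊤ : ℕ∞) f → ∀ t,
      HasDerivAt (fun t => c + ∫ τ in (0 : ℝ)..t, f τ) (f t) t := fun c hf t =>
    ((hf.continuous.integral_hasStrictDerivAt 0 t).hasDerivAt).const_add c
  have hY := fun t => hvec (hint (c 0) hφ.cos t) (hint (c 1) hφ.sin t)
  refine ⟨_, (contDiff_piLp 2).2 fun i => ?_, ?_, hY, fun t => ?_⟩
  · fin_cases i
    · exact contDiff_const_add_integral (c 0) hφ.cos
    · exact contDiff_const_add_integral (c 1) hφ.sin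
  · ext i; fin_cases i <;> simp
  · have hφt : HasDerivAt φ (deriv φ t) t := (hφ.differentiable (by simp) t).hasDerivAt
    rw [funext fun t => (hY t).deriv, (hvec hφt.cos hφt.sin).deriv]
    simp [mul_comm]

theorem norm_vec_two_sq (u v : ℝ) : ‖(!₂[u, v] : EuclideanSpace ℝ (Fin 2))‖ ^ 2 = u ^ 2 + v ^ 2 := by
  simp [EuclideanSpace.norm_sq_eq]

theorem norm_cos_sin_sub_le (α β : ℝ) :
    ‖(!₂[Real.cos α, Real.sin α] - !₂[Real.cos β, Real.sin β] : EuclideanSpace ℝ (Fin 2))‖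
      ≤ 2 * |α - β| := by
  refine le_of_sq_le_sq ?_ (by positivity)
  have h1 := sq_le_sq' (neg_le_of_abs_le (Real.abs_cos_sub_cos_le α β))
    (le_of_abs_le (Real.abs_cos_sub_cos_le α β))
  have h2 := sq_le_sq' (neg_le_of_abs_le (Real.abs_sin_sub_sin_le α β))
    (le_of_abs_le (Real.abs_sin_sub_sin_le α β))
  rw [EuclideanSpace.norm_sq_eq]
  simp only [Fin.sum_univ_two, PiLp.sub_apply, Real.norm_eq_abs, sq_abs, Matrix.cons_val_zero,
    Matrix.cons_val_one]
  nlinarith [sq_nonneg (|α - β|)]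

/-- A unit-speed curve with square integrable second derivative has a tangent angle `θ` which is
a primitive of its signed curvature `κ`. -/
theorem exists_angle_of_unit_speed {L : ℝ} (hL : 0 < L) {yd g : ℝ → EuclideanSpace ℝ (Fin 2)}
    (hAC : ∀ s ∈ Set.Icc 0 L, ∀ t ∈ Set.Icc 0 L, yd t - yd s = ∫ τ in s..t, g τ)
    (hgmeas : Measurable g)
    (hgL2 : IntegrableOn (fun t => ‖g t‖ ^ 2) (Set.Ioo 0 L))
    (hunit : ∀ t ∈ Set.Icc 0 L, ‖yd t‖ = 1) :
    ∃ (κ : ℝ → ℝ) (θ₀ : ℝ), MemLp κ 2 (volume.restrict (Set.Ioo 0 L)) ∧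
      IntervalIntegrable κ volume 0 L ∧
      (∀ t ∈ Set.Icc 0 L, yd t = !₂[Real.cos (θ₀ + ∫ τ in (0 : ℝ)..t, κ τ),
        Real.sin (θ₀ + ∫ τ in (0 : ℝ)..t, κ τ)]) ∧
      ∀ᵐ t ∂(volume.restrict (Set.Ioo 0 L)), g t =
        !₂[-(κ t * Real.sin (θ₀ + ∫ τ in (0 : ℝ)..t, κ τ)),
          κ t * Real.cos (θ₀ + ∫ τ in (0 : ℝ)..t, κ τ)] := by
  have hii : ∀ {E : Type} [NormedAddCommGroup E] {f : ℝ → E},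
      MemLp f 2 (volume.restrict (Set.Ioo 0 L)) → IntervalIntegrable f volume 0 L := by
    intro E _ f hf
    rw [intervalIntegrable_iff_integrableOn_Ioo_of_le hL.le]
    exact hf.integrable (by norm_num)
  have hg2 : MemLp g 2 (volume.restrict (Set.Ioo 0 L)) :=
    (memLp_two_iff_integrable_sq_norm hgmeas.aestronglyMeasurable).2 hgL2
  have hgi := hii hg2
  have hcoord : ∀ i, MemLp (fun t => g t i) 2 (volume.restrict (Set.Ioo 0 L)) := fun i =>
    (EuclideanSpace.proj (𝕜 := ℝ) i).comp_memLp' hg2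
  have h0 : (0 : ℝ) ∈ Set.Icc 0 L := ⟨le_rfl, hL.le⟩
  have hprim : ∀ i, ∀ t ∈ Set.Icc 0 L, yd t i = yd 0 i + ∫ τ in (0 : ℝ)..t, g τ i := by
    intro i t ht
    have h1 := congrArg (EuclideanSpace.proj (𝕜 := ℝ) i) (hAC 0 h0 t ht)
    rw [← ContinuousLinearMap.intervalIntegral_comp_comm _ (hgi.mono_set (by
      rw [Set.uIcc_of_le ht.1, Set.uIcc_of_le hL.le]; exact Set.Icc_subset_Icc_right ht.2))] at h1
    simp only [map_sub, PiLp.proj_apply] at h1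
    linarith
  set p : ℝ → ℝ := fun t => yd 0 0 + ∫ τ in (0 : ℝ)..t, g τ 0 with hp
  set q : ℝ → ℝ := fun t => yd 0 1 + ∫ τ in (0 : ℝ)..t, g τ 1 with hq
  have hpq : ∀ t ∈ Set.Icc 0 L, p t ^ 2 + q t ^ 2 = 1 := by
    intro t ht
    have h1 := EuclideanSpace.norm_sq_eq (yd t)
    simp only [hunit t ht, Fin.sum_univ_two, Real.norm_eq_abs, sq_abs, hprim _ t ht] at h1
    rw [← h1, one_pow]
  have hmeas : ∀ i, AEStronglyMeasurable (fun t => yd 0 i + ∫ τ in (0 : ℝ)..t, g τ i)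
      (volume.restrict (Set.Ioo 0 L)) := fun i => by
    have h1 := (absolutelyContinuousOnInterval_const_add_integral (yd 0 i)
      (hii (hcoord i))).continuousOn
    rw [Set.uIcc_of_le hL.le] at h1
    exact (h1.mono Set.Ioo_subset_Icc_self).aestronglyMeasurable measurableSet_Ioo
  set κ : ℝ → ℝ := fun t => g t 1 * p t - g t 0 * q t with hκdef
  have hκ2 : MemLp κ 2 (volume.restrict (Set.Ioo 0 L)) := by
    refine ((hcoord 1).norm.add (hcoord 0).norm).mono'
      (((hcoord 1).1.mul (hmeas 0)).sub ((hcoord 0).1.mul (hmeas 1))) ?_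
    filter_upwards [ae_restrict_mem measurableSet_Ioo] with t ht
    have h1 := hpq t (Set.Ioo_subset_Icc_self ht)
    have hp1 : |p t| ≤ 1 := abs_le_one_iff_mul_self_le_one.2 (by nlinarith [sq_nonneg (q t)])
    have hq1 : |q t| ≤ 1 := abs_le_one_iff_mul_self_le_one.2 (by nlinarith [sq_nonneg (p t)])
    refine (norm_sub_le _ _).trans (add_le_add ?_ ?_)
    · rw [norm_mul]; exact mul_le_of_le_one_right (norm_nonneg _) hp1
    · rw [norm_mul]; exact mul_le_of_le_one_right (norm_nonneg _) hq1
  have htan := ae_tangential_of_unit_circle hL (hii (hcoord 0)) (hii (hcoord 1)) hp hq hpq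
  obtain ⟨θ₀, hθ⟩ := exists_angle_of_unit_circle hL (hii (hcoord 0)) (hii (hcoord 1)) (hii hκ2)
    hp hq hpq htan
  refine ⟨κ, θ₀, hκ2, hii hκ2, fun t ht => ?_, ?_⟩
  · ext i
    fin_cases i
    · exact (hprim 0 t ht).trans (hθ t ht).1
    · exact (hprim 1 t ht).trans (hθ t ht).2
  · filter_upwards [ae_restrict_of_ae htan, ae_restrict_mem measurableSet_Ioo] with t htan ht
    obtain ⟨h1, h2⟩ := hθ t (Set.Ioo_subset_Icc_self ht)
    obtain ⟨h3, h4⟩ := htan ht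
    rw [← h1, ← h2]
    ext i
    fin_cases i
    · exact h3
    · exact h4

theorem exists_smooth_unit_speed_approx {L : ℝ} (hL : 0 < L)
    {y yd g : ℝ → EuclideanSpace ℝ (Fin 2)}
    (hderiv : ∀ t ∈ Set.Icc 0 L, HasDerivWithinAt y (yd t) (Set.Icc 0 L) t)
    (hAC : ∀ s ∈ Set.Icc 0 L, ∀ t ∈ Set.Icc 0 L, yd t - yd s = ∫ τ in s..t, g τ)
    (hgmeas : Measurable g)
    (hgL2 : IntegrableOn (fun t => ‖g t‖ ^ 2) (Set.Ioo 0 L))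
    (hunit : ∀ t ∈ Set.Icc 0 L, ‖yd t‖ = 1) :
    ∃ C : ℝ, 0 < C ∧ ∀ ε : ℝ, 0 < ε → ε ≤ 1 → ∃ Y : ℝ → EuclideanSpace ℝ (Fin 2),
      ContDiff ℝ (⊤ : ℕ∞) Y ∧ (∀ t, ‖deriv Y t‖ = 1) ∧
      (∀ t ∈ Set.Icc 0 L, ‖Y t - y t‖ ≤ C * ε) ∧
      (∀ t ∈ Set.Icc 0 L, ‖deriv Y t - yd t‖ ≤ C * ε) ∧
      (∫ t in Set.Ioo 0 L, ‖deriv (deriv Y) t - g t‖ ^ 2) ≤ C * ε ∧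
      (∫ t in Set.Ioo 0 L, ((deriv (deriv Y) t 1 * deriv Y t 0
        - deriv (deriv Y) t 0 * deriv Y t 1) - (g t 1 * yd t 0 - g t 0 * yd t 1)) ^ 2)
        ≤ C * ε := by
  obtain ⟨κ, θ₀, hκ2, hκi, hyd, hg⟩ := exists_angle_of_unit_speed hL hAC hgmeas hgL2 hunit
  set θ : ℝ → ℝ := fun t => θ₀ + ∫ τ in (0 : ℝ)..t, κ τ with hθ
  set K : ℝ := ∫ t in Set.Ioo 0 L, κ t ^ 2 with hK
  have hK0 : 0 ≤ K := integral_nonneg fun t => sq_nonneg _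
  set D : ℝ := 2 * (L + 1) with hD
  have hD0 : 0 < D := by positivity
  have h0 : (0 : ℝ) ∈ Set.Icc 0 L := ⟨le_rfl, hL.le⟩
  refine ⟨D + D * L + 2 + 2 * D ^ 2 * K, by positivity, fun ε hε hε1 => ?_⟩
  have hε2 : ε ^ 2 ≤ ε := by nlinarith
  obtain ⟨k, hk, hkm, hkle⟩ := exists_contDiff_setIntegral_sq_sub_le hκ2 hε
  set φ : ℝ → ℝ := fun t => θ₀ + ∫ τ in (0 : ℝ)..t, k τ with hφ
  have hφd : ∀ t, deriv φ t = k t := fun t =>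
    (((hk.continuous.integral_hasStrictDerivAt 0 t).hasDerivAt).const_add θ₀).deriv
  have hφθ : ∀ t ∈ Set.Icc 0 L, |φ t - θ t| ≤ (L + 1) * ε := by
    intro t ht
    have h1 := abs_integral_le_of_setIntegral_sq_le hL hε hkm hkle ht
    rw [intervalIntegral.integral_sub (hk.continuous.intervalIntegrable _ _)
      (hκi.mono_set (by
        rw [Set.uIcc_of_le ht.1, Set.uIcc_of_le hL.le]; exact Set.Icc_subset_Icc_right ht.2))] at h1
    simpa [hφ, hθ] using h1
  obtain ⟨Y, hY, hY0, hYd, hYdd⟩ :=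
    exists_contDiff_deriv_eq_cos_sin (contDiff_const_add_integral θ₀ hk) (y 0)
  have hYd' : ∀ t, deriv Y t = !₂[Real.cos (φ t), Real.sin (φ t)] := fun t => (hYd t).deriv
  have hYdd' : ∀ t, deriv (deriv Y) t = !₂[-(k t * Real.sin (φ t)), k t * Real.cos (φ t)] :=
    fun t => by rw [hYdd t]; change !₂[-(deriv φ t * _), deriv φ t * _] = _; rw [hφd]
  have hv : ∀ t ∈ Set.Icc 0 L, ‖deriv Y t - yd t‖ ≤ D * ε := by
    intro t ht
    rw [hYd', hyd t ht]
    refine (norm_cos_sin_sub_le _ _).trans ?_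
    rw [hD, mul_assoc]
    exact mul_le_mul_of_nonneg_left (hφθ t ht) zero_le_two
  refine ⟨Y, hY, fun t => ?_, fun t ht => ?_, fun t ht => ?_, ?_, ?_⟩
  · rw [hYd', ← sq_eq_sq₀ (norm_nonneg _) zero_le_one, norm_vec_two_sq, Real.cos_sq_add_sin_sq,
      one_pow]
  · have h1 := (convex_Icc 0 L).norm_image_sub_le_of_norm_hasDerivWithin_le
      (f := fun t => Y t - y t) (fun s hs => (hYd s).hasDerivWithinAt.sub (hderiv s hs))
      (fun s hs => by rw [← hYd']; exact hv s hs) h0 ht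
    simp only [hY0, sub_self, sub_zero, Real.norm_eq_abs, abs_of_nonneg ht.1] at h1
    refine h1.trans ?_
    calc D * ε * t ≤ D * ε * L := by gcongr; exact ht.2
      _ = D * L * ε := by ring
      _ ≤ _ := by gcongr; nlinarith [mul_nonneg (sq_nonneg D) hK0]
  · refine (hv t ht).trans ?_
    gcongr
    nlinarith [mul_nonneg (sq_nonneg D) hK0, mul_pos hD0 hL]
  · have hint : Integrable (fun t => 2 * (k t - κ t) ^ 2 + 2 * (D * ε) ^ 2 * κ t ^ 2)
        (volume.restrict (Set.Ioo 0 L)) :=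
      (hkm.integrable_sq.const_mul 2).add (hκ2.integrable_sq.const_mul _)
    calc ∫ t in Set.Ioo 0 L, ‖deriv (deriv Y) t - g t‖ ^ 2
        ≤ ∫ t in Set.Ioo 0 L, (2 * (k t - κ t) ^ 2 + 2 * (D * ε) ^ 2 * κ t ^ 2) := by
          refine integral_mono_of_nonneg (.of_forall fun _ => sq_nonneg _) hint ?_
          filter_upwards [hg, ae_restrict_mem measurableSet_Ioo] with t hgt ht
          have h1 := hv t (Set.Ioo_subset_Icc_self ht)
          rw [hYd', hyd t (Set.Ioo_subset_Icc_self ht)] at h1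
          have h2 := pow_le_pow_left₀ (norm_nonneg _) h1 2
          rw [EuclideanSpace.norm_sq_eq] at h2
          rw [hYdd', hgt, EuclideanSpace.norm_sq_eq]
          simp only [Fin.sum_univ_two, PiLp.sub_apply, Real.norm_eq_abs, sq_abs,
            Matrix.cons_val_zero, Matrix.cons_val_one] at h2 ⊢
          change _ ≤ 2 * (k t - κ t) ^ 2 + 2 * (D * ε) ^ 2 * κ t ^ 2
          have h3 := mul_le_mul_of_nonneg_left h2 (sq_nonneg (κ t))
          have h4 := Real.cos_sq_add_sin_sq (φ t)
          change _ * ((Real.cos (φ t) - Real.cos (θ t)) ^ 2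
            + (Real.sin (φ t) - Real.sin (θ t)) ^ 2) ≤ _ at h3
          change (-(k t * Real.sin (φ t)) - -(κ t * Real.sin (θ t))) ^ 2
            + (k t * Real.cos (φ t) - κ t * Real.cos (θ t)) ^ 2 ≤ _
          generalize Real.cos (φ t) = c at *
          generalize Real.sin (φ t) = s at *
          generalize Real.cos (θ t) = c' at *
          generalize Real.sin (θ t) = s' at *
          have h5 : (k t - κ t) ^ 2 * (c ^ 2 + s ^ 2) = (k t - κ t) ^ 2 := by rw [h4, mul_one]
          nlinarith [sq_nonneg ((k t - κ t) * s - κ t * (s - s')),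
            sq_nonneg ((k t - κ t) * c - κ t * (c - c'))]
      _ = 2 * (∫ t in Set.Ioo 0 L, (k t - κ t) ^ 2) + 2 * (D * ε) ^ 2 * K := by
          rw [integral_add (hkm.integrable_sq.const_mul 2) (hκ2.integrable_sq.const_mul _),
            integral_const_mul, integral_const_mul]
      _ ≤ 2 * ε ^ 2 + 2 * (D * ε) ^ 2 * K := by gcongr
      _ = (2 + 2 * D ^ 2 * K) * ε ^ 2 := by ring
      _ ≤ (D + D * L + 2 + 2 * D ^ 2 * K) * ε := by
          gcongr
          nlinarith [mul_pos hD0 hL]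
  · calc _ = ∫ t in Set.Ioo 0 L, (k t - κ t) ^ 2 := by
          refine integral_congr_ae ?_
          filter_upwards [hg, ae_restrict_mem measurableSet_Ioo] with t hgt ht
          rw [hYdd', hYd', hgt, hyd t (Set.Ioo_subset_Icc_self ht)]
          change ((k t * Real.cos (φ t)) * Real.cos (φ t) - (-(k t * Real.sin (φ t)))
            * Real.sin (φ t) - ((κ t * Real.cos (θ t)) * Real.cos (θ t)
            - (-(κ t * Real.sin (θ t))) * Real.sin (θ t))) ^ 2 = _
          congr 1
          linear_combination k t * Real.cos_sq_add_sin_sq (φ t)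
            - κ t * Real.cos_sq_add_sin_sq (θ t)
      _ ≤ ε ^ 2 := hkle
      _ = 1 * ε ^ 2 := (one_mul _).symm
      _ ≤ (D + D * L + 2 + 2 * D ^ 2 * K) * ε := by
          gcongr
          nlinarith [mul_pos hD0 hL, mul_nonneg (sq_nonneg D) hK0]

/-! STATEMENT 9: Smooth approximation of unit-speed `W^{2,2}` curves. A `C¹` curve
`y : [0,L] → ℝ²` with absolutely continuous derivative `y'` (with a.e. second derivative
`y'' = g ∈ L²`), `|y'| ≡ 1` and `sup |y| < M`, can be approximated by smooth unit-speed
curves `y_k` with `sup |y_k| < M`, with `y_k → y`, `y_k' → y'` uniformly and `y_k'' → y''`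
in `L²`; in particular the curvatures converge in `L²`. -/

theorem smooth_approximation_of_unit_speed_curves
    (L M : ℝ) (hL : 0 < L) (hLM : L < M)
    (y yd g : ℝ → EuclideanSpace ℝ (Fin 2))
    -- `y` is continuously differentiable on `[0,L]` with derivative `yd`
    (hderiv : ∀ t ∈ Set.Icc 0 L, HasDerivWithinAt y (yd t) (Set.Icc 0 L) t)
    -- `yd` is absolutely continuous with derivative `g`
    (hAC : ∀ s ∈ Set.Icc 0 L, ∀ t ∈ Set.Icc 0 L, yd t - yd s = ∫ τ in s..t, g τ)
    (hgmeas : Measurable g)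
    -- `y'' = g ∈ L²((0,L))`
    (hgL2 : IntegrableOn (fun t => ‖g t‖ ^ 2) (Set.Ioo 0 L))
    -- unit speed
    (hunit : ∀ t ∈ Set.Icc 0 L, ‖yd t‖ = 1)
    -- `sup_{[0,L]} |y| < M`
    (hbd : ∀ t ∈ Set.Icc 0 L, ‖y t‖ < M) :
    ∃ yk : ℕ → ℝ → EuclideanSpace ℝ (Fin 2),
      (∀ k, ContDiff ℝ (⊤ : ℕ∞) (yk k)) ∧
      (∀ k, ∀ t ∈ Set.Icc 0 L, ‖deriv (yk k) t‖ = 1) ∧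
      (∀ k, ∀ t ∈ Set.Icc 0 L, ‖yk k t‖ < M) ∧
      TendstoUniformlyOn (fun k => yk k) y atTop (Set.Icc 0 L) ∧
      TendstoUniformlyOn (fun k t => deriv (yk k) t) yd atTop (Set.Icc 0 L) ∧
      Tendsto (fun k => ∫ t in Set.Ioo 0 L, ‖deriv (deriv (yk k)) t - g t‖ ^ 2)
        atTop (𝓝 0) ∧
      -- curvatures κ_k = y_k''·(y_k')^⊥ converge in L² to κ = y''·(y')^⊥
      Tendsto (fun k => ∫ t in Set.Ioo 0 L,
          ((deriv (deriv (yk k)) t 1 * deriv (yk k) t 0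
            - deriv (deriv (yk k)) t 0 * deriv (yk k) t 1)
          - (g t 1 * yd t 0 - g t 0 * yd t 1)) ^ 2)
        atTop (𝓝 0) := by
  obtain ⟨C, hC, happ⟩ := exists_smooth_unit_speed_approx hL hderiv hAC hgmeas hgL2 hunit
  have hy : ContinuousOn y (Set.Icc 0 L) := fun t ht => (hderiv t ht).continuousWithinAt
  obtain ⟨t₀, ht₀, hmax⟩ := isCompact_Icc.exists_isMaxOn (Set.nonempty_Icc.2 hL.le) hy.norm
  have hgap : 0 < M - ‖y t₀‖ := sub_pos.2 (hbd t₀ ht₀)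
  set δ : ℝ := min 1 ((M - ‖y t₀‖) / (2 * C)) with hδ
  have hδ0 : 0 < δ := by positivity
  have hδC : C * δ < M - ‖y t₀‖ := by
    have h1 : δ ≤ (M - ‖y t₀‖) / (2 * C) := min_le_right _ _
    rw [le_div_iff₀ (by positivity)] at h1
    nlinarith
  have hεle : ∀ n : ℕ, δ / (n + 1) ≤ δ := fun n =>
    div_le_self hδ0.le (by linarith [n.cast_nonneg (α := ℝ)])
  choose Y hY hYu hYy hYd hYg hYκ using fun n : ℕ =>
    happ (δ / (n + 1)) (by positivity) ((hεle n).trans (min_le_left _ _))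
  have hlim : Tendsto (fun n : ℕ => C * (δ / (n + 1))) atTop (𝓝 0) := by
    have h1 := tendsto_one_div_add_atTop_nhds_zero_nat (𝕜 := ℝ)
    simpa [div_eq_mul_inv] using (h1.const_mul δ).const_mul C
  have hunif : ∀ {F : ℕ → ℝ → EuclideanSpace ℝ (Fin 2)} {f : ℝ → EuclideanSpace ℝ (Fin 2)},
      (∀ n, ∀ t ∈ Set.Icc 0 L, ‖F n t - f t‖ ≤ C * (δ / (n + 1))) →
      TendstoUniformlyOn F f atTop (Set.Icc 0 L) := by
    intro F f h
    rw [Metric.tendstoUniformlyOn_iff]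
    intro ε hε
    filter_upwards [hlim.eventually_lt_const hε] with n hn t ht
    rw [dist_comm, dist_eq_norm]
    exact (h n t ht).trans_lt hn
  refine ⟨Y, hY, fun n t _ => hYu n t, fun n t ht => ?_, hunif hYy, hunif hYd,
    squeeze_zero (fun n => integral_nonneg fun t => sq_nonneg _) hYg hlim,
    squeeze_zero (fun n => integral_nonneg fun t => sq_nonneg _) hYκ hlim⟩
  have h1 := norm_le_norm_add_norm_sub' (Y n t) (y t)
  have h2 := hYy n t ht
  have h3 : C * (δ / (n + 1)) ≤ C * δ := mul_le_mul_of_nonneg_left (hεle n) hC.le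
  have h4 : ‖y t‖ ≤ ‖y t₀‖ := hmax ht
  linarith
end
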